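/- arXiv:cs/0606033 — 3 statements merged into one kernel-verified Lean document; each statement's English description precedes it below -/
import Mathlib

section
/- The zeta number ζ_U of a universal self-delimiting Turing machine U is (algorithmically) random: for every binary digit sequence x : ℕ → Bool with ζ_U = ∑_{i≥0} (x i)·2^{-(i+1)}, there exists a constant c ≥ 0 such that for all m ≥ 1, H_U(x_0 x_1 ⋯ x_{m−1}) ≥ m − c. -/
open scoped ENNReal

/-- The domain of a Turing machine (a partial function on binary strings). -/
def dom (f : List Bool →. List Bool) : Set (List Bool) := {p | (f p).Dom}

/-- A machine is self-delimiting if its domain is prefix-free. -/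
def SelfDelim (f : List Bool →. List Bool) : Prop :=
  ∀ p ∈ dom f, ∀ q ∈ dom f, p <+: q → p = q

/-- Chaitin's Omega number of a machine, in `[0,∞]`. -/
noncomputable def Omega (f : List Bool →. List Bool) : ℝ≥0∞ :=
  ∑' p : dom f, (2 : ℝ≥0∞)⁻¹ ^ (p : List Bool).length

/-- `bin n` is the binary expansion of `n` with the leading 1 removed. -/
def bin (n : ℕ) : List Bool := (Nat.bits n).reverse.tail

/-- `Υ[A]`: the set of positive integers whose `bin`-code lies in `A`. -/
def Ups (A : Set (List Bool)) : Set ℕ := {n | 1 ≤ n ∧ bin n ∈ A}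

/-- The zeta number of a machine, in `[0,∞]`. -/
noncomputable def zeta (f : List Bool →. List Bool) : ℝ≥0∞ :=
  ∑' n : Ups (dom f), ((n : ℕ) : ℝ≥0∞)⁻¹

/-- `U` is a universal self-delimiting Turing machine. -/
def UnivSD (U : List Bool →. List Bool) : Prop :=
  SelfDelim U ∧ ∀ C : List Bool →. List Bool, Partrec C → SelfDelim C →
    ∃ c : ℕ, ∀ x ∈ dom C, ∃ p : List Bool, p.length ≤ x.length + c ∧ U p = C x

/-- `T` is a universal (plain) Turing machine. -/
def UnivTM (T : List Bool →. List Bool) : Prop :=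
  ∀ C : List Bool →. List Bool, Partrec C →
    ∃ c : ℕ, ∀ x ∈ dom C, ∃ p : List Bool, p.length ≤ x.length + c ∧ T p = C x

/-- Program-size / plain complexity of a string w.r.t. a machine. -/
noncomputable def Cpx (f : List Bool →. List Bool) (y : List Bool) : ℕ :=
  sInf {n : ℕ | ∃ w : List Bool, w.length = n ∧ y ∈ f w}

/-- Natural complexity of a string w.r.t. a machine, with `min ∅ = ∞`. -/
noncomputable def nabla (f : List Bool →. List Bool) (y : List Bool) : ℝ≥0∞ :=
  sInf {c : ℝ≥0∞ | ∃ n : ℕ, 1 ≤ n ∧ y ∈ f (bin n) ∧ c = (n : ℝ≥0∞)}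

/-- The real number with binary digit sequence `x`. -/
noncomputable def realDigits (x : ℕ → Bool) : ℝ :=
  ∑' i : ℕ, (if x i then (1 : ℝ) else 0) * (2 : ℝ)⁻¹ ^ (i + 1)

/-- The extended nonnegative real with binary digit sequence `x`. -/
noncomputable def ennDigits (x : ℕ → Bool) : ℝ≥0∞ :=
  ∑' i : ℕ, (if x i then (1 : ℝ≥0∞) else 0) * (2 : ℝ≥0∞)⁻¹ ^ (i + 1)

/-- The string of the first `m` digits of the sequence `x`. -/
def prefixStr (x : ℕ → Bool) (m : ℕ) : List Bool := (List.range m).map x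

/-- A real is computable if it is approximated to within `2⁻ⁿ` by a computable
sequence of rationals. -/
def ComputableReal (s : ℝ) : Prop :=
  ∃ f : ℕ → ℚ, Computable f ∧ ∀ n : ℕ, |s - (f n : ℝ)| ≤ (2 : ℝ)⁻¹ ^ n

/-! ### The enumeration `bin` of binary strings -/

theorem bin_bit (n : ℕ) (b : Bool) (hn : 1 ≤ n) : bin (Nat.bit b n) = bin n ++ [b] := by
  have hbits : n.bits ≠ [] := by
    intro h
    have hsize := Nat.size_eq_bits_len n
    rw [h, List.length_nil, eq_comm, Nat.size_eq_zero] at hsize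
    omega
  rw [bin, Nat.bits_append_bit n b (by omega), List.reverse_cons,
    List.tail_append_of_ne_nil (by simpa using hbits), bin]

theorem exists_bin_eq (p : List Bool) : ∃ n, 1 ≤ n ∧ bin n = p ∧ n < 2 ^ (p.length + 1) := by
  induction p using List.reverseRecOn with
  | nil => exact ⟨1, le_rfl, by simp [bin], by simp⟩
  | append_singleton p b ih =>
    obtain ⟨n, hn, rfl, hlt⟩ := ih
    refine ⟨Nat.bit b n, ?_, bin_bit n b hn, ?_⟩
    · rw [Nat.bit_val]; omega
    · rw [Nat.bit_val, List.length_append, List.length_singleton, pow_succ]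
      cases b <;> simp <;> omega

theorem primrec_bits : Primrec Nat.bits := by
  let g (l : List (List Bool)) : Option (List Bool) :=
    if l.length = 0 then some []
    else (l[l.length.div2]?).map fun t => l.length.bodd :: t
  have hg : Primrec g :=
    Primrec.ite (Primrec.eq.comp Primrec.list_length (Primrec.const 0)) (Primrec.const _)
      (Primrec.option_map
        (Primrec.list_getElem?.comp Primrec.id (Primrec.nat_div2.comp Primrec.list_length))
        (Primrec.list_cons.comp
          (Primrec.nat_bodd.comp (Primrec.list_length.comp Primrec.fst)) Primrec.snd).to₂)
  have key : Primrec₂ fun (_ : Unit) n => Nat.bits n := by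
    refine Primrec.nat_strong_rec _ (g := fun _ l => g l) (hg.comp Primrec.snd).to₂ fun _ n => ?_
    rcases Nat.eq_zero_or_pos n with rfl | hn
    · simp [g]
    · have hlt : n.div2 < n := by rw [Nat.div2_val]; omega
      have hbits : n.bodd :: n.div2.bits = n.bits := by
        rw [← Nat.bits_append_bit, Nat.bit_bodd_div2]
        intro h
        have := Nat.bodd_add_div2 n
        cases hb : n.bodd <;> simp_all
      simp [g, hn.ne', List.getElem?_range hlt, hbits]
  exact key.comp (Primrec.const ()) Primrec.id

theorem primrec_bin : Primrec bin :=
  Primrec.list_tail.comp (Primrec.list_reverse.comp primrec_bits)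

/-! ### Primitive recursive auxiliary functions -/

theorem primrec_factorial : Primrec Nat.factorial := by
  refine (Primrec.nat_rec₁ 1 (f := fun n m => (n + 1) * m)
    (Primrec.nat_mul.comp (Primrec.succ.comp Primrec.fst) Primrec.snd)).of_eq fun n => ?_
  induction n with
  | zero => rfl
  | succ n ih => simp only [Nat.factorial_succ, ← ih]

theorem primrec_sum_range {α : Type*} [Primcodable α] {f : α → ℕ} {g : α → ℕ → ℕ}
    (hf : Primrec f) (hg : Primrec₂ g) : Primrec fun a => ∑ n ∈ Finset.range (f a), g a n := by
  refine (Primrec.nat_rec' hf (Primrec.const 0) (h := fun a p => p.2 + g a p.1)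
    (Primrec.nat_add.comp (Primrec.snd.comp Primrec.snd)
      (hg.comp Primrec.fst (Primrec.fst.comp Primrec.snd))).to₂).of_eq fun a => ?_
  induction f a with
  | zero => rfl
  | succ n ih => rw [Finset.sum_range_succ, ← ih]

/-- A partial recursive function is the increasing union of a primitive recursive sequence of
finite approximations. -/
theorem Partrec.exists_stages {α σ : Type*} [Primcodable α] [Primcodable σ] {f : α →. σ}
    (hf : Partrec f) : ∃ g : ℕ → α → Option σ, Primrec₂ g ∧
      (∀ k l a y, k ≤ l → g k a = some y → g l a = some y) ∧
      ∀ a y, y ∈ f a ↔ ∃ k, g k a = some y := by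
  obtain ⟨c, hc⟩ := Nat.Partrec.Code.exists_code.1 hf
  have heval (a : α) : c.eval (Encodable.encode a) = (f a).map Encodable.encode := by
    rw [hc]; simp
  refine ⟨fun k a => (c.evaln k (Encodable.encode a)).bind Encodable.decode, ?_, ?_, ?_⟩
  · exact Primrec.option_bind
      (Nat.Partrec.Code.primrec_evaln.comp
        ((Primrec.fst.pair (Primrec.const c)).pair (Primrec.encode.comp Primrec.snd)))
      (Primrec.decode.comp Primrec.snd).to₂
  · intro k l a y hkl h
    obtain ⟨e, he, hy⟩ := Option.bind_eq_some_iff.1 h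
    exact Option.bind_eq_some_iff.2 ⟨e, Nat.Partrec.Code.evaln_mono hkl he, hy⟩
  · intro a y
    constructor
    · intro hy
      have hmem : Encodable.encode y ∈ c.eval (Encodable.encode a) := by
        rw [heval]; exact Part.mem_map _ hy
      obtain ⟨k, hk⟩ := Nat.Partrec.Code.evaln_complete.1 hmem
      exact ⟨k, Option.bind_eq_some_iff.2 ⟨_, hk, Encodable.encodek y⟩⟩
    · rintro ⟨k, hk⟩
      obtain ⟨e, he, hy⟩ := Option.bind_eq_some_iff.1 hk
      have hmem := Nat.Partrec.Code.evaln_sound he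
      rw [heval] at hmem
      obtain ⟨z, hz, rfl⟩ := (Part.mem_map_iff _).1 hmem
      rw [Encodable.encodek, Option.some_inj] at hy
      exact hy ▸ hz

/-! ### Binary digits -/

/-- The natural number with big-endian binary digits `y`. -/
def strVal (y : List Bool) : ℕ := y.foldl (fun s b => 2 * s + cond b 1 0) 0

theorem primrec_strVal : Primrec strVal :=
  Primrec.list_foldl (h := fun _ p => 2 * p.1 + cond p.2 1 0) Primrec.id (Primrec.const 0)
    (Primrec.nat_add.comp
      (Primrec.nat_double.comp (Primrec.fst.comp Primrec.snd))
      (Primrec.cond (Primrec.snd.comp Primrec.snd) (Primrec.const 1) (Primrec.const 0))).to₂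

theorem length_prefixStr (x : ℕ → Bool) (m : ℕ) : (prefixStr x m).length = m := by
  simp [prefixStr]

theorem sum_digits_eq (x : ℕ → Bool) (m : ℕ) :
    ∑ i ∈ Finset.range m, (if x i then (1 : ℝ) else 0) * (2 : ℝ)⁻¹ ^ (i + 1) =
      strVal (prefixStr x m) * (2 : ℝ)⁻¹ ^ m := by
  induction m with
  | zero => simp [strVal, prefixStr]
  | succ m ih =>
    have hval : strVal (prefixStr x (m + 1)) =
        2 * strVal (prefixStr x m) + cond (x m) 1 0 := by
      simp [strVal, prefixStr, List.range_succ]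
    rw [Finset.sum_range_succ, ih, hval]
    cases x m <;> simp [pow_succ] <;> ring

theorem digit_term_le (x : ℕ → Bool) (i : ℕ) :
    (if x i then (1 : ℝ) else 0) * (2 : ℝ)⁻¹ ^ (i + 1) ≤ (2 : ℝ)⁻¹ ^ (i + 1) := by
  cases x i <;> simp

theorem digit_term_nonneg (x : ℕ → Bool) (i : ℕ) :
    0 ≤ (if x i then (1 : ℝ) else 0) * (2 : ℝ)⁻¹ ^ (i + 1) := by
  cases x i <;> simp

theorem hasSum_geometric_inv_two_tail (m : ℕ) :
    HasSum (fun i : ℕ => (2 : ℝ)⁻¹ ^ (i + m + 1)) ((2 : ℝ)⁻¹ ^ m) := by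
  have h := (hasSum_geometric_of_lt_one (r := (2 : ℝ)⁻¹) (by norm_num) (by norm_num)).mul_right
    ((2 : ℝ)⁻¹ ^ (m + 1))
  have hval : (1 - (2 : ℝ)⁻¹)⁻¹ * (2 : ℝ)⁻¹ ^ (m + 1) = (2 : ℝ)⁻¹ ^ m := by
    rw [pow_succ', ← mul_assoc]; norm_num
  rw [hval] at h
  simpa only [← pow_add, ← add_assoc] using h

theorem summable_digits (x : ℕ → Bool) :
    Summable fun i : ℕ => (if x i then (1 : ℝ) else 0) * (2 : ℝ)⁻¹ ^ (i + 1) :=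
  Summable.of_nonneg_of_le (digit_term_nonneg x) (digit_term_le x)
    (by simpa using (hasSum_geometric_inv_two_tail 0).summable)

theorem strVal_prefixStr_le (x : ℕ → Bool) (m : ℕ) :
    strVal (prefixStr x m) * (2 : ℝ)⁻¹ ^ m ≤ realDigits x := by
  rw [← sum_digits_eq]
  exact (summable_digits x).sum_le_tsum _ fun i _ => digit_term_nonneg x i

theorem realDigits_le (x : ℕ → Bool) (m : ℕ) :
    realDigits x ≤ (strVal (prefixStr x m) + 1) * (2 : ℝ)⁻¹ ^ m := by
  rw [realDigits, ← (summable_digits x).sum_add_tsum_nat_add m, sum_digits_eq, add_mul, one_mul,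
    ← (hasSum_geometric_inv_two_tail m).tsum_eq]
  exact add_le_add_right (Summable.tsum_le_tsum (fun i => digit_term_le x (i + m))
    ((summable_nat_add_iff m).2 (summable_digits x)) (hasSum_geometric_inv_two_tail m).summable) _

theorem realDigits_nonneg (x : ℕ → Bool) : 0 ≤ realDigits x :=
  tsum_nonneg (digit_term_nonneg x)

theorem ennDigits_eq_ofReal (x : ℕ → Bool) : ennDigits x = ENNReal.ofReal (realDigits x) := by
  rw [realDigits, ENNReal.ofReal_tsum_of_nonneg (digit_term_nonneg x) (summable_digits x),
    ennDigits]
  congr 1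
  ext i
  rw [ENNReal.ofReal_mul (by split_ifs <;> simp), ENNReal.ofReal_pow (by norm_num),
    ENNReal.ofReal_inv_of_pos (by norm_num), ENNReal.ofReal_ofNat]
  split_ifs <;> simp

/-! ### The zeta number as a real series -/

theorem hasSum_of_zeta_eq {f : List Bool →. List Bool} {x : ℕ → Bool}
    (hx : zeta f = ennDigits x) :
    HasSum ((Ups (dom f)).indicator fun n => (n : ℝ)⁻¹) (realDigits x) := by
  rw [← hasSum_subtype_iff_indicator]
  have hne : zeta f ≠ ⊤ := by
    rw [hx, ennDigits_eq_ofReal]; exact ENNReal.ofReal_ne_top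
  have h := ENNReal.hasSum_toReal hne
  rw [← ENNReal.tsum_toReal_eq (fun a => ENNReal.ne_top_of_tsum_ne_top hne a), ← zeta, hx,
    ennDigits_eq_ofReal, ENNReal.toReal_ofReal (realDigits_nonneg x)] at h
  convert h using 1
  ext n
  simp

theorem sum_inv_le_of_hasSum {A : Set ℕ} {α : ℝ}
    (h : HasSum (A.indicator fun n => (n : ℝ)⁻¹) α) {s : Finset ℕ} (hs : ∀ n ∈ s, n ∈ A) :
    ∑ n ∈ s, (n : ℝ)⁻¹ ≤ α := by
  rw [← Finset.sum_congr rfl fun n hn => Set.indicator_of_mem (hs n hn) fun n : ℕ => (n : ℝ)⁻¹]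
  exact sum_le_hasSum s (fun n _ => Set.indicator_nonneg (fun _ _ => by positivity) n) h

theorem exists_lt_sum_inv_of_hasSum {A : Set ℕ} {α β : ℝ}
    (h : HasSum (A.indicator fun n => (n : ℝ)⁻¹) α) (hβ : β < α) :
    ∃ s : Finset ℕ, (∀ n ∈ s, n ∈ A) ∧ β < ∑ n ∈ s, (n : ℝ)⁻¹ := by
  classical
  obtain ⟨s, hs⟩ := (h.eventually_const_lt hβ).exists
  refine ⟨s.filter (· ∈ A), fun n hn => (Finset.mem_filter.1 hn).2, ?_⟩
  rwa [Finset.sum_filter]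

/-! ### Finite stages of an enumeration -/

/-- The positive integers below `k` on which the approximation `g k` is defined. -/
def stageSet (g : ℕ → ℕ → Option (List Bool)) (k : ℕ) : Finset ℕ :=
  (Finset.range k).filter fun n => 1 ≤ n ∧ (g k n).isSome

/-- `k!` times the sum of the reciprocals of the members of `stageSet g k`. -/
def stageSum (g : ℕ → ℕ → Option (List Bool)) (k : ℕ) : ℕ :=
  ∑ n ∈ Finset.range k, if (g k n).isSome then k.factorial / n else 0

theorem primrec_stageSum {g : ℕ → ℕ → Option (List Bool)} (hg : Primrec₂ g) :
    Primrec (stageSum g) := by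
  have hterm : Primrec₂ fun k n => if (g k n).isSome then k.factorial / n else 0 :=
    Primrec.ite (Primrec.eq.comp (Primrec.option_isSome.comp hg) (Primrec.const true))
      (Primrec.nat_div.comp (primrec_factorial.comp Primrec.fst) Primrec.snd) (Primrec.const 0)
  exact primrec_sum_range Primrec.id hterm

theorem stageSum_eq (g : ℕ → ℕ → Option (List Bool)) (k : ℕ) :
    (stageSum g k : ℝ) = k.factorial * ∑ n ∈ stageSet g k, (n : ℝ)⁻¹ := by
  rw [stageSum, stageSet, Finset.sum_filter, Finset.mul_sum, Nat.cast_sum]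
  refine Finset.sum_congr rfl fun n hn => ?_
  rcases Nat.eq_zero_or_pos n with rfl | hpos
  · simp
  · have hdvd : n ∣ k.factorial := Nat.dvd_factorial hpos (Finset.mem_range.1 hn).le
    have hne : (n : ℝ) ≠ 0 := by positivity
    cases h : (g k n).isSome
    · simp
    · simp [Nat.one_le_iff_ne_zero.1 hpos, Nat.one_le_iff_ne_zero,
        Nat.cast_div hdvd hne, div_eq_mul_inv]

theorem exists_subset_stageSet {g : ℕ → ℕ → Option (List Bool)}
    (hmono : ∀ k l n y, k ≤ l → g k n = some y → g l n = some y) (s : Finset ℕ)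
    (hs : ∀ n ∈ s, 1 ≤ n ∧ ∃ k y, g k n = some y) : ∃ k, s ⊆ stageSet g k := by
  classical
  induction s using Finset.induction_on with
  | empty => exact ⟨0, Finset.empty_subset _⟩
  | insert a s _ ih =>
    obtain ⟨k, hk⟩ := ih fun n hn => hs n (Finset.mem_insert_of_mem hn)
    obtain ⟨ha, l, y, hy⟩ := hs a (Finset.mem_insert_self a s)
    refine ⟨max (max k l) (a + 1), fun n hn => ?_⟩
    rw [stageSet, Finset.mem_filter, Finset.mem_range]
    rcases Finset.mem_insert.1 hn with rfl | hn
    · exact ⟨by omega, ha, by rw [hmono l _ n y (by omega) hy]; rfl⟩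
    · have hmem := hk hn
      rw [stageSet, Finset.mem_filter, Finset.mem_range] at hmem
      obtain ⟨z, hz⟩ := Option.isSome_iff_exists.1 hmem.2.2
      exact ⟨by omega, hmem.2.1, by rw [hmono k _ n z (by omega) hz]; rfl⟩

/-- A string longer than every value taken by `g k` below `k`. -/
def freshStr (g : ℕ → ℕ → Option (List Bool)) (k : ℕ) : List Bool :=
  ((List.range k).flatMap fun n => (g k n).getD []) ++ [true]

theorem primrec_freshStr {g : ℕ → ℕ → Option (List Bool)} (hg : Primrec₂ g) :
    Primrec (freshStr g) :=
  Primrec.list_append.comp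
    (Primrec.list_flatMap Primrec.list_range
      (Primrec.option_getD.comp hg (Primrec.const [])).to₂)
    (Primrec.const _)

theorem ne_freshStr {g : ℕ → ℕ → Option (List Bool)} {k n : ℕ} {y : List Bool} (hn : n < k)
    (hy : g k n = some y) : y ≠ freshStr g k := by
  intro h
  have hsub : y.Sublist ((List.range k).flatMap fun n => (g k n).getD []) := by
    rw [List.flatMap]
    exact List.sublist_flatten_of_mem (List.mem_map.2 ⟨n, List.mem_range.2 hn, by simp [hy]⟩)
  have hlen := hsub.length_le
  rw [h, freshStr, List.length_append, List.length_singleton] at hlen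
  omega

/-- Whether the `k`-th partial sum exceeds the dyadic rational coded by `y` minus one unit in its
last place. -/
def enoughStages (g : ℕ → ℕ → Option (List Bool)) (y : List Bool) (k : ℕ) : Bool :=
  decide (strVal y * k.factorial < stageSum g k * 2 ^ y.length + k.factorial)

theorem primrec_enoughStages {g : ℕ → ℕ → Option (List Bool)} (hg : Primrec₂ g) :
    Primrec₂ (enoughStages g) := by
  have hpow : Primrec₂ fun a b : ℕ => a ^ b := Primrec₂.unpaired'.1 Nat.Primrec.pow
  have hfac : Primrec fun p : List Bool × ℕ => p.2.factorial := primrec_factorial.comp Primrec.snd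
  exact PrimrecPred.decide (Primrec.nat_lt.comp
    (Primrec.nat_mul.comp (primrec_strVal.comp Primrec.fst) hfac)
    (Primrec.nat_add.comp
      (Primrec.nat_mul.comp ((primrec_stageSum hg).comp Primrec.snd)
        (hpow.comp (Primrec.const 2) (Primrec.list_length.comp Primrec.fst))) hfac))

theorem enoughStages_iff (g : ℕ → ℕ → Option (List Bool)) (y : List Bool) (k : ℕ) :
    enoughStages g y k = true ↔
      (strVal y - 1) * (2 : ℝ)⁻¹ ^ y.length < ∑ n ∈ stageSet g k, (n : ℝ)⁻¹ := by
  have hfac : (0 : ℝ) < k.factorial := by positivity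
  rw [enoughStages, decide_eq_true_iff, ← Nat.cast_lt (α := ℝ)]
  push_cast
  rw [stageSum_eq, inv_pow, ← div_eq_mul_inv, div_lt_iff₀ (by positivity),
    ← mul_lt_mul_iff_of_pos_left (a := (k.factorial : ℝ)) (b := (strVal y : ℝ) - 1) hfac]
  constructor <;> intro h <;> linarith

/-- The machine that, from a program for `y`, searches for a stage whose partial sum is close to
the dyadic rational coded by `y` and prints a string not produced at that stage. -/
def freshMachine (U : List Bool →. List Bool) (g : ℕ → ℕ → Option (List Bool)) :
    List Bool →. List Bool := fun w =>
  (U w).bind fun y => (Nat.rfind fun k => Part.some (enoughStages g y k)).map (freshStr g)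

theorem partrec_freshMachine {U : List Bool →. List Bool} {g : ℕ → ℕ → Option (List Bool)}
    (hU : Partrec U) (hg : Primrec₂ g) : Partrec (freshMachine U g) := by
  refine hU.bind (Partrec.map (f := fun p : List Bool × List Bool =>
    Nat.rfind fun k => Part.some (enoughStages g p.2 k)) (Partrec.rfind ?_)
    ((primrec_freshStr hg).comp Primrec.snd).to_comp.to₂)
  exact ((primrec_enoughStages hg).comp (Primrec.snd.comp Primrec.fst)
    Primrec.snd).to_comp.partrec.to₂

theorem SelfDelim.mono {f g : List Bool →. List Bool} (hf : SelfDelim f) (h : dom g ⊆ dom f) :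
    SelfDelim g := fun p hp q hq => hf p (h hp) q (h hq)

theorem UnivSD.exists_program {U : List Bool →. List Bool} (h : UnivSD U) (y : List Bool) :
    ∃ w, y ∈ U w := by
  let C : List Bool →. List Bool := fun p => ((if p = [] then some y else none : Option _) : Part _)
  have hC : Partrec C := Computable.ofOption
    (Primrec.ite (Primrec.eq.comp Primrec.id (Primrec.const [])) (Primrec.const _)
      (Primrec.const _)).to_comp
  have hnil (p : List Bool) (hp : p ∈ dom C) : p = [] := by
    by_contra hne
    simp [dom, C, hne] at hp
  obtain ⟨c, hc⟩ := h.2 C hC fun p hp q hq _ => by rw [hnil p hp, hnil q hq]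
  obtain ⟨p, -, hp⟩ := hc [] (by simp [dom, C])
  exact ⟨p, by rw [hp]; simp [C]⟩

theorem UnivSD.exists_length_eq_cpx {U : List Bool →. List Bool} (h : UnivSD U) (y : List Bool) :
    ∃ w, w.length = Cpx U y ∧ y ∈ U w := by
  obtain ⟨w, hw⟩ := h.exists_program y
  exact Nat.sInf_mem (s := {n | ∃ w : List Bool, w.length = n ∧ y ∈ U w}) ⟨_, w, rfl, hw⟩

/-- The zeta number of a universal self-delimiting Turing machine is
(algorithmically) random. -/
theorem stmt_4 (U : List Bool →. List Bool) (hU : Partrec U) (huniv : UnivSD U)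
    (x : ℕ → Bool) (hx : zeta U = ennDigits x) :
    ∃ c : ℝ, 0 ≤ c ∧ ∀ m : ℕ, 1 ≤ m → (Cpx U (prefixStr x m) : ℝ) ≥ m - c := by
  obtain ⟨g, hg, hmono, hcompl⟩ := (hU.comp primrec_bin.to_comp).exists_stages
  have hsum := hasSum_of_zeta_eq hx
  have hstage (k n : ℕ) (hn : n ∈ stageSet g k) : n ∈ Ups (dom U) := by
    obtain ⟨-, hpos, hsome⟩ := Finset.mem_filter.1 hn
    obtain ⟨y, hy⟩ := Option.isSome_iff_exists.1 hsome
    exact ⟨hpos, Part.dom_iff_mem.2 ⟨y, (hcompl n y).2 ⟨k, hy⟩⟩⟩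
  have hsd : SelfDelim (freshMachine U g) := huniv.1.mono fun _ hp => hp.1
  obtain ⟨c, hc⟩ := huniv.2 _ (partrec_freshMachine hU hg) hsd
  refine ⟨c + 1, by positivity, fun m _ => ?_⟩
  obtain ⟨w, hw, hyw⟩ := huniv.exists_length_eq_cpx (prefixStr x m)
  have hpow : (0 : ℝ) < (2 : ℝ)⁻¹ ^ m := by positivity
  obtain ⟨s, hsA, hs⟩ := exists_lt_sum_inv_of_hasSum hsum
    (β := (strVal (prefixStr x m) - 1) * (2 : ℝ)⁻¹ ^ m)
    (by linarith [strVal_prefixStr_le x m])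
  obtain ⟨k₀, hk₀⟩ := exists_subset_stageSet hmono s fun n hn => by
    obtain ⟨y, hy⟩ := Part.dom_iff_mem.1 (hsA n hn).2
    obtain ⟨k, hk⟩ := (hcompl n y).1 hy
    exact ⟨(hsA n hn).1, k, y, hk⟩
  have henough : enoughStages g (prefixStr x m) k₀ = true := by
    rw [enoughStages_iff, length_prefixStr]
    exact hs.trans_le (Finset.sum_le_sum_of_subset_of_nonneg hk₀ fun _ _ _ => by positivity)
  obtain ⟨k, hk, -⟩ := Nat.rfind_min' (p := enoughStages g (prefixStr x m)) henough
  have hlow : (strVal (prefixStr x m) - 1) * (2 : ℝ)⁻¹ ^ m < ∑ n ∈ stageSet g k, (n : ℝ)⁻¹ := by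
    have htrue := Part.mem_some_iff.1 (Nat.rfind_spec hk)
    simpa [length_prefixStr] using (enoughStages_iff g _ k).1 htrue.symm
  have hfresh : freshStr g k ∈ freshMachine U g w :=
    Part.mem_bind_iff.2 ⟨_, hyw, Part.mem_map _ hk⟩
  obtain ⟨p, hplen, hp⟩ := hc w (Part.dom_iff_mem.2 ⟨_, hfresh⟩)
  rw [← hp] at hfresh
  obtain ⟨q, hq, rfl, hqlt⟩ := exists_bin_eq p
  have hqA : q ∈ Ups (dom U) := ⟨hq, Part.dom_iff_mem.2 ⟨_, hfresh⟩⟩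
  have hqk : q ∉ stageSet g k := by
    intro hmem
    obtain ⟨hlt, -, hsome⟩ := Finset.mem_filter.1 hmem
    obtain ⟨y, hy⟩ := Option.isSome_iff_exists.1 hsome
    exact ne_freshStr (Finset.mem_range.1 hlt) hy
      (Part.mem_unique ((hcompl q y).2 ⟨k, hy⟩) hfresh)
  have hup : ∑ n ∈ insert q (stageSet g k), (n : ℝ)⁻¹ ≤ realDigits x :=
    sum_inv_le_of_hasSum hsum fun n hn => by
      rcases Finset.mem_insert.1 hn with rfl | hn
      · exact hqA
      · exact hstage k n hn
  rw [Finset.sum_insert hqk] at hup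
  have hqinv : (q : ℝ)⁻¹ < 2 * ((2 : ℝ) ^ m)⁻¹ := by
    rw [← inv_pow]
    linarith [realDigits_le x m]
  have hq0 : (0 : ℝ) < q := by exact_mod_cast hq
  have hmq : 2 ^ m < 2 * q := by
    rw [inv_lt_iff_one_lt_mul₀ hq0, ← div_eq_mul_inv, div_mul_eq_mul_div,
      lt_div_iff₀ (by positivity), one_mul] at hqinv
    exact_mod_cast hqinv
  have hmlt : m < (bin q).length + 2 := by
    refine (Nat.pow_lt_pow_iff_right (a := 2) one_lt_two).1 ?_
    rw [pow_succ]
    omega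
  have hfinal : m ≤ Cpx U (prefixStr x m) + c + 1 := by omega
  have hcast : (m : ℝ) ≤ Cpx U (prefixStr x m) + c + 1 := by exact_mod_cast hfinal
  linarith
end

section
/- For each tuatara machine V there exists a self-delimiting Turing machine C such that Ω_C = ζ_V. Moreover, if V is a universal tuatara machine, then C can be chosen to be a universal self-delimiting Turing machine. -/
open scoped ENNReal

/-- `V` is a universal tuatara machine: a tuatara machine universal for the
class of tuatara machines. -/
def UnivTuatara (V : List Bool →. List Bool) : Prop :=
  zeta V ≤ 1 ∧ ∀ C : List Bool →. List Bool, Partrec C → zeta C ≤ 1 →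
    ∃ c : ℕ, ∀ x ∈ dom C, ∃ p : List Bool, p.length ≤ x.length + c ∧ V p = C x

/-- The number whose binary expansion is that of `i` followed by the digits `w`. -/
def appendDigits (i : ℕ) (w : List Bool) : ℕ := w.foldl (fun n b => 2 * n + b.toNat) i

theorem appendDigits_concat (i : ℕ) (w : List Bool) (b : Bool) :
    appendDigits i (w ++ [b]) = 2 * appendDigits i w + b.toNat := by
  simp [appendDigits]

theorem appendDigits_cons (i : ℕ) (w : List Bool) (b : Bool) :
    appendDigits i (b :: w) = appendDigits (2 * i + b.toNat) w := rfl

theorem appendDigits_eq (i : ℕ) (w : List Bool) :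
    appendDigits i w = i * 2 ^ w.length + appendDigits 0 w := by
  induction w generalizing i with
  | nil => simp [appendDigits]
  | cons b w ih =>
    rw [appendDigits_cons, appendDigits_cons, ih, ih (2 * 0 + _)]
    simp only [List.length_cons]
    ring

theorem appendDigits_zero_lt (w : List Bool) : appendDigits 0 w < 2 ^ w.length := by
  induction w using List.reverseRecOn with
  | nil => simp [appendDigits]
  | append_singleton w b ih =>
    rw [appendDigits_concat, List.length_append, List.length_singleton, pow_succ]
    have := b.toNat_le
    omega

theorem one_le_appendDigits_one (w : List Bool) : 1 ≤ appendDigits 1 w := by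
  rw [appendDigits_eq]
  have := Nat.one_le_two_pow (n := w.length)
  omega

theorem bits_appendDigits_one (w : List Bool) :
    (Nat.bits (appendDigits 1 w)).reverse = true :: w := by
  induction w using List.reverseRecOn with
  | nil => simp [appendDigits]
  | append_singleton w b ih =>
    have h := one_le_appendDigits_one w
    have e : appendDigits 1 (w ++ [b]) = Nat.bit b (appendDigits 1 w) := by
      rw [appendDigits_concat, Nat.bit_val]
    rw [e, Nat.bits_append_bit _ _ (by omega), List.reverse_cons, ih]
    rfl

theorem bin_appendDigits_one (w : List Bool) : bin (appendDigits 1 w) = w := by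
  rw [bin, bits_appendDigits_one, List.tail_cons]

theorem appendDigits_one_bin {n : ℕ} (hn : 1 ≤ n) : appendDigits 1 (bin n) = n := by
  obtain ⟨w, rfl⟩ : ∃ w, n = appendDigits 1 w := by
    induction n using Nat.strong_induction_on with
    | _ n ih =>
      obtain rfl | h := hn.eq_or_lt
      · exact ⟨[], rfl⟩
      · obtain ⟨w, hw⟩ := ih (n / 2) (by omega) (by omega)
        refine ⟨w ++ [decide (n % 2 = 1)], ?_⟩
        rw [appendDigits_concat, ← hw]
        obtain h2 | h2 := Nat.mod_two_eq_zero_or_one n <;> simp [h2] <;> omega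
  rw [bin_appendDigits_one]

theorem primrec_appendDigits (i : ℕ) : Primrec (appendDigits i) :=
  Primrec.list_foldl (f := fun w : List Bool => w) (g := fun _ => i)
    (h := fun _ (q : ℕ × Bool) => 2 * q.1 + q.2.toNat) Primrec.id (Primrec.const i)
    (Primrec.nat_add.comp
      (Primrec.nat_mul.comp (Primrec.const 2) (Primrec.fst.comp Primrec.snd))
      ((Primrec.dom_bool Bool.toNat).comp (Primrec.snd.comp Primrec.snd))).to₂

theorem primrec_two_pow : Primrec (fun n : ℕ => 2 ^ n) :=
  (Primrec.nat_rec₁ (f := fun _ m => 2 * m) 1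
    (Primrec.nat_mul.comp (Primrec.const 2) Primrec.snd).to₂).of_eq fun n => by
      induction n with
      | zero => rfl
      | succ n ih => simp only [pow_succ] at ih ⊢; rw [← ih, mul_comm]

/-- A sequence of halting events listing each element of the domain of `V` exactly once,
together with the corresponding output. -/
structure Enumerates (e : ℕ → Option (List Bool × List Bool)) (V : List Bool →. List Bool) :
    Prop where
  mem : ∀ {p y s}, e s = some (p, y) → y ∈ V p
  exists_of_mem : ∀ {p y}, y ∈ V p → ∃ s, e s = some (p, y)
  inj : ∀ {p y y' s s'}, e s = some (p, y) → e s' = some (p, y') → s = s'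

theorem exists_computable_enumerates {V : List Bool →. List Bool} (hV : Partrec V) :
    ∃ e, Computable e ∧ Enumerates e V := by
  obtain ⟨c, hc⟩ := Nat.Partrec.Code.exists_code.1 hV
  have hmem : ∀ {p y}, y ∈ V p ↔ Encodable.encode y ∈ c.eval (Encodable.encode p) := by
    intro p y
    rw [hc]
    simp
  let e : ℕ → Option (List Bool × List Bool) := fun s =>
    (Encodable.decode (α := List Bool × ℕ) s).bind fun q =>
      if Encodable.encode q = s ∧ c.evaln q.2 (Encodable.encode q.1) = none then
        ((c.evaln (q.2 + 1) (Encodable.encode q.1)).bind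
          (Encodable.decode (α := List Bool))).map fun y => (q.1, y)
      else none
  have heq : ∀ s p y, e s = some (p, y) ↔ ∃ k, Encodable.encode (p, k) = s ∧
      c.evaln k (Encodable.encode p) = none ∧
      c.evaln (k + 1) (Encodable.encode p) = some (Encodable.encode y) := by
    intro s p y
    simp only [e, Option.bind_eq_some_iff, Option.ite_none_right_eq_some, Option.map_eq_some_iff]
    constructor
    · rintro ⟨q, -, ⟨h1, h2⟩, y', ⟨z, hz, hy⟩, h⟩
      obtain ⟨rfl, rfl⟩ : q.1 = p ∧ y' = y := by simpa using h
      refine ⟨q.2, h1, h2, ?_⟩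
      obtain ⟨x, -, rfl⟩ : ∃ x ∈ V q.1, Encodable.encode x = z := by
        have := Nat.Partrec.Code.evaln_sound hz
        rw [hc] at this
        simpa using this
      rw [Encodable.encodek, Option.some_inj] at hy
      rw [← hy]
      exact hz
    · rintro ⟨k, rfl, h1, h2⟩
      exact ⟨(p, k), Encodable.encodek _, ⟨rfl, h1⟩, y, ⟨_, h2, Encodable.encodek _⟩, rfl⟩
  have he : Primrec e := by
    have hs : Primrec fun x : ℕ × List Bool × ℕ => x.1 := Primrec.fst
    have hq : Primrec fun x : ℕ × List Bool × ℕ => x.2 := Primrec.snd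
    have hp := Primrec.encode.comp (Primrec.fst.comp hq)
    have hv {f : ℕ × List Bool × ℕ → ℕ} (hf : Primrec f) :
        Primrec fun x => c.evaln (f x) (Encodable.encode x.2.1) :=
      Nat.Partrec.Code.primrec_evaln.comp ((hf.pair (Primrec.const c)).pair hp)
    have h1 : Primrec fun x : ℕ × List Bool × ℕ =>
        (c.evaln (x.2.2 + 1) (Encodable.encode x.2.1)).bind
          (Encodable.decode (α := List Bool)) :=
      Primrec.option_bind (hv (Primrec.succ.comp (Primrec.snd.comp hq)))
        (Primrec.decode.comp Primrec.snd).to₂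
    have h2 := Primrec.option_map h1
      ((Primrec.fst.comp (hq.comp Primrec.fst)).pair Primrec.snd).to₂
    have hc : PrimrecPred fun x : ℕ × List Bool × ℕ =>
        Encodable.encode x.2 = x.1 ∧ c.evaln x.2.2 (Encodable.encode x.2.1) = none :=
      (Primrec.eq.comp (Primrec.encode.comp hq) hs).and
        (Primrec.eq.comp (hv (Primrec.snd.comp hq)) (Primrec.const none))
    exact Primrec.option_bind Primrec.decode (Primrec.ite hc h2 (Primrec.const none)).to₂
  refine ⟨e, he.to_comp, ?_, ?_, ?_⟩
  · intro p y s h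
    obtain ⟨k, -, -, h⟩ := (heq _ _ _).1 h
    exact hmem.2 (Nat.Partrec.Code.evaln_sound h)
  · intro p y h
    have hk := Nat.Partrec.Code.evaln_complete.1 (hmem.1 h)
    have hsome : ∃ k, (c.evaln k (Encodable.encode p)).isSome :=
      hk.imp fun k hk => Option.isSome_iff_exists.2 ⟨_, hk⟩
    obtain ⟨k, hk1, hk2⟩ : ∃ k, c.evaln k (Encodable.encode p) = none ∧
        (c.evaln (k + 1) (Encodable.encode p)).isSome := by
      have h1 := Nat.find_spec hsome
      obtain h0 | ⟨k, h0⟩ := Nat.eq_zero_or_eq_succ_pred (Nat.find hsome) |>.imp_right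
        fun h => (⟨_, h⟩ : ∃ k, Nat.find hsome = k + 1)
      · rw [h0] at h1
        simp [Nat.Partrec.Code.evaln] at h1
      · refine ⟨k, ?_, h0 ▸ h1⟩
        simpa using Nat.find_min hsome (m := k) (by omega)
    obtain ⟨z, hz⟩ := Option.isSome_iff_exists.1 hk2
    refine ⟨_, (heq _ _ _).2 ⟨k, rfl, hk1, ?_⟩⟩
    rw [hz, Part.mem_unique (Nat.Partrec.Code.evaln_sound hz) (hmem.1 h)]
  · intro p y y' s s' h h'
    obtain ⟨k, rfl, h1, h2⟩ := (heq _ _ _).1 h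
    obtain ⟨k', rfl, h1', h2'⟩ := (heq _ _ _).1 h'
    have key : ∀ {i j z}, c.evaln i (Encodable.encode p) = none →
        c.evaln (j + 1) (Encodable.encode p) = some z → i ≤ j := by
      intro i j z hi hj
      by_contra! hlt
      have := Nat.Partrec.Code.evaln_mono (Nat.succ_le_of_lt hlt) hj
      rw [hi] at this
      cases this
    rw [le_antisymm (key h1 h2') (key h1' h2)]

/-- Partial sums of `1 / n` over the halting events, as a numerator and a denominator. -/
def partialSum (e : ℕ → Option (List Bool × List Bool)) (s : ℕ) : ℕ × ℕ :=
  Nat.rec (0, 1) (fun i q => Option.casesOn (e i) q fun r =>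
    (q.1 * appendDigits 1 r.1 + q.2, q.2 * appendDigits 1 r.1)) s

theorem computable_partialSum {e : ℕ → Option (List Bool × List Bool)} (he : Computable e) :
    Computable (partialSum e) := by
  refine Computable.nat_rec (f := fun s : ℕ => s) (g := fun _ => ((0, 1) : ℕ × ℕ))
    (h := fun _ (q : ℕ × ℕ × ℕ) => Option.casesOn (e q.1) q.2 fun r =>
    (q.2.1 * appendDigits 1 r.1 + q.2.2, q.2.2 * appendDigits 1 r.1)) Computable.id
    (Computable.const _) ?_
  refine Computable.option_casesOn (he.comp (Computable.fst.comp Computable.snd))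
    (Computable.snd.comp Computable.snd) ?_
  have hq : Primrec fun x : (ℕ × ℕ × ℕ × ℕ) × List Bool × List Bool => x.1.2.2 :=
    Primrec.snd.comp (Primrec.snd.comp Primrec.fst)
  have hr : Primrec fun x : (ℕ × ℕ × ℕ × ℕ) × List Bool × List Bool => appendDigits 1 x.2.1 :=
    (primrec_appendDigits 1).comp (Primrec.fst.comp Primrec.snd)
  exact (Primrec.pair
    (Primrec.nat_add.comp (Primrec.nat_mul.comp (Primrec.fst.comp hq) hr) (Primrec.snd.comp hq))
    (Primrec.nat_mul.comp (Primrec.snd.comp hq) hr)).to_comp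

/-- Whether `[v / 2 ^ l, (v + 1) / 2 ^ l)` lies between the fractions `q` and `q'`. -/
def between (q q' : ℕ × ℕ) (v l : ℕ) : Bool :=
  decide (q.1 * 2 ^ l ≤ v * q.2) && decide ((v + 1) * q'.2 ≤ q'.1 * 2 ^ l)

/-- Whether the dyadic interval of `w` is maximal among those between `q` and `q'`. -/
def maxBetween (q q' : ℕ × ℕ) (w : List Bool) : Bool :=
  between q q' (appendDigits 0 w) w.length &&
    (decide (w.length = 0) || !between q q' (appendDigits 0 w / 2) (w.length - 1))

theorem primrec_between :
    Primrec fun x : (ℕ × ℕ) × (ℕ × ℕ) × ℕ × ℕ => between x.1 x.2.1 x.2.2.1 x.2.2.2 := by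
  have hl : Primrec fun x : (ℕ × ℕ) × (ℕ × ℕ) × ℕ × ℕ => 2 ^ x.2.2.2 :=
    primrec_two_pow.comp (Primrec.snd.comp (Primrec.snd.comp Primrec.snd))
  have hv : Primrec fun x : (ℕ × ℕ) × (ℕ × ℕ) × ℕ × ℕ => x.2.2.1 :=
    Primrec.fst.comp (Primrec.snd.comp Primrec.snd)
  have hq : Primrec fun x : (ℕ × ℕ) × (ℕ × ℕ) × ℕ × ℕ => x.2.1 := Primrec.fst.comp Primrec.snd
  refine Primrec.and.comp ?_ ?_
  · exact Primrec.nat_le.decide.comp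
      (Primrec.nat_mul.comp (Primrec.fst.comp Primrec.fst) hl)
      (Primrec.nat_mul.comp hv (Primrec.snd.comp Primrec.fst))
  · exact Primrec.nat_le.decide.comp
      (Primrec.nat_mul.comp (Primrec.succ.comp hv) (Primrec.snd.comp hq))
      (Primrec.nat_mul.comp (Primrec.fst.comp hq) hl)

theorem primrec_maxBetween :
    Primrec fun x : (ℕ × ℕ) × (ℕ × ℕ) × List Bool => maxBetween x.1 x.2.1 x.2.2 := by
  have hw : Primrec fun x : (ℕ × ℕ) × (ℕ × ℕ) × List Bool => x.2.2 :=
    Primrec.snd.comp Primrec.snd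
  have hl := Primrec.list_length.comp hw
  have hv := (primrec_appendDigits 0).comp hw
  have hb {f g : (ℕ × ℕ) × (ℕ × ℕ) × List Bool → ℕ} (hf : Primrec f) (hg : Primrec g) :
      Primrec fun x => between x.1 x.2.1 (f x) (g x) :=
    primrec_between.comp (Primrec.pair Primrec.fst (Primrec.pair
      (Primrec.fst.comp Primrec.snd) (Primrec.pair hf hg)))
  exact Primrec.and.comp (hb hv hl) (Primrec.or.comp
    (Primrec.eq.decide.comp hl (Primrec.const 0))
    (Primrec.not.comp (hb (Primrec.nat_div.comp hv (Primrec.const 2))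
      (Primrec.nat_sub.comp hl (Primrec.const 1)))))

/-- The output of the halting event `s`, provided `w` is a program carrying it. -/
def eventOutput (e : ℕ → Option (List Bool × List Bool)) (w : List Bool) (s : ℕ) :
    Option (List Bool) :=
  bif maxBetween (partialSum e s) (partialSum e (s + 1)) w then (e s).map Prod.snd else none

/-- The machine reading off the output of the halting event whose interval contains
the dyadic interval of its program maximally. -/
def intervalMachine (e : ℕ → Option (List Bool × List Bool)) : List Bool →. List Bool :=
  fun w => Nat.rfindOpt (eventOutput e w)

theorem computable_bif_maxBetween {a : ℕ → ℕ × ℕ} (ha : Computable a)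
    {f : ℕ → Option (List Bool)} (hf : Computable f) :
    Computable₂ fun (w : List Bool) s => bif maxBetween (a s) (a (s + 1)) w then f s else none := by
  have hs : Computable fun x : List Bool × ℕ => x.2 := Computable.snd
  have hc := primrec_maxBetween.to_comp.comp
    ((ha.comp hs).pair ((ha.comp (Computable.succ.comp hs)).pair Computable.fst))
  exact Computable.cond hc (hf.comp hs) (Computable.const none)

theorem partrec_intervalMachine {e : ℕ → Option (List Bool × List Bool)} (he : Computable e) :
    Partrec (intervalMachine e) :=
  Partrec.rfindOpt (computable_bif_maxBetween (computable_partialSum he)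
    (Computable.option_map he (Computable.snd.comp Computable.snd).to₂))

/-- The half-open dyadic subinterval of `[0, 1)` of reals whose binary expansion starts
with `w`. -/
def dyadic : List Bool → Set ℝ
  | [] => Set.Ico 0 1
  | b :: w => {x | 2 * x - b.toNat ∈ dyadic w}

theorem dyadic_eq_Ico (w : List Bool) :
    dyadic w = Set.Ico ((appendDigits 0 w : ℝ) / 2 ^ w.length)
      ((appendDigits 0 w + 1 : ℝ) / 2 ^ w.length) := by
  induction w with
  | nil => simp [dyadic, appendDigits]
  | cons b w ih =>
    ext x
    have hpos : (0 : ℝ) < 2 ^ w.length := by positivity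
    have e : (appendDigits 0 (b :: w) : ℝ) = b.toNat * 2 ^ w.length + appendDigits 0 w := by
      rw [appendDigits_cons, appendDigits_eq]
      simp
    simp only [dyadic, ih, Set.mem_ofPred_eq, Set.mem_Ico, e, List.length_cons, pow_succ]
    rw [div_le_iff₀ hpos, lt_div_iff₀ hpos, div_le_iff₀ (by positivity),
      lt_div_iff₀ (by positivity)]
    constructor <;> rintro ⟨h1, h2⟩ <;> constructor <;> linarith

theorem dyadic_subset_Ico (w : List Bool) : dyadic w ⊆ Set.Ico 0 1 := by
  induction w with
  | nil => exact subset_rfl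
  | cons b w ih =>
    intro x hx
    obtain ⟨h1, h2⟩ := ih hx
    constructor <;> cases b <;> simp at h1 h2 <;> linarith

theorem dyadic_append_subset (u v : List Bool) : dyadic (u ++ v) ⊆ dyadic u := by
  induction u with
  | nil => exact dyadic_subset_Ico v
  | cons b u ih => exact fun x hx => ih hx

theorem prefix_or_prefix_of_mem_dyadic {u v : List Bool} {x : ℝ} (hu : x ∈ dyadic u)
    (hv : x ∈ dyadic v) : u <+: v ∨ v <+: u := by
  induction u generalizing v x with
  | nil => exact Or.inl List.nil_prefix
  | cons b u ih =>
    cases v with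
    | nil => exact Or.inr List.nil_prefix
    | cons b' v =>
      obtain ⟨h1, h2⟩ := dyadic_subset_Ico _ hu
      obtain ⟨h3, h4⟩ := dyadic_subset_Ico _ hv
      have hu' := dyadic_subset_Ico u hu
      have hv' := dyadic_subset_Ico v hv
      obtain rfl : b = b' := by
        cases b <;> cases b' <;> simp at hu' hv' ⊢ <;> linarith [hu'.1, hu'.2, hv'.1, hv'.2]
      simpa [List.cons_prefix_cons] using ih hu hv

theorem exists_length_eq_mem_dyadic (l : ℕ) {x : ℝ} (hx : x ∈ Set.Ico (0 : ℝ) 1) :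
    ∃ w, w.length = l ∧ x ∈ dyadic w := by
  induction l generalizing x with
  | zero => exact ⟨[], rfl, hx⟩
  | succ l ih =>
    obtain ⟨b, hb⟩ : ∃ b : Bool, 2 * x - b.toNat ∈ Set.Ico (0 : ℝ) 1 := by
      obtain h | h := lt_or_ge (2 * x) 1
      · exact ⟨false, by simp [hx.1, h]⟩
      · refine ⟨true, ?_, ?_⟩ <;> simp <;> linarith [hx.2]
    obtain ⟨w, hw, hxw⟩ := ih hb
    exact ⟨b :: w, by simp [hw], hxw⟩

theorem dyadic_subset_Ico_iff {w : List Bool} {a b : ℝ} :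
    dyadic w ⊆ Set.Ico a b ↔ a ≤ appendDigits 0 w / 2 ^ w.length ∧
      (appendDigits 0 w + 1) / 2 ^ w.length ≤ b := by
  rw [dyadic_eq_Ico, Set.Ico_subset_Ico_iff]
  gcongr
  linarith

theorem dyadic_nonempty (w : List Bool) : (dyadic w).Nonempty := by
  rw [dyadic_eq_Ico, Set.nonempty_Ico]
  gcongr
  linarith

theorem measurableSet_dyadic (w : List Bool) : MeasurableSet (dyadic w) :=
  dyadic_eq_Ico w ▸ measurableSet_Ico

theorem volume_dyadic (w : List Bool) :
    MeasureTheory.volume (dyadic w) = (2 : ℝ≥0∞)⁻¹ ^ w.length := by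
  rw [dyadic_eq_Ico, Real.volume_Ico, ← sub_div, add_sub_cancel_left, one_div, ← inv_pow,
    ENNReal.ofReal_pow (by norm_num), ENNReal.ofReal_inv_of_pos (by norm_num)]
  simp

theorem Omega_eq_volume {C : List Bool →. List Bool} (hC : SelfDelim C) :
    Omega C = MeasureTheory.volume (⋃ w ∈ dom C, dyadic w) := by
  rw [MeasureTheory.measure_biUnion (Set.to_countable _) ?_ fun w _ => measurableSet_dyadic w]
  · simp only [volume_dyadic]
    rfl
  · intro u hu v hv huv
    refine Set.disjoint_left.2 fun x hxu hxv => huv ?_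
    obtain h | h := prefix_or_prefix_of_mem_dyadic hxu hxv
    exacts [hC u hu v hv h, (hC v hv u hu h).symm]

theorem Omega_le_one {C : List Bool →. List Bool} (hC : SelfDelim C) : Omega C ≤ 1 := by
  rw [Omega_eq_volume hC]
  calc _ ≤ MeasureTheory.volume (Set.Ico (0 : ℝ) 1) :=
        MeasureTheory.measure_mono (Set.iUnion₂_subset fun w _ => dyadic_subset_Ico w)
    _ = 1 := by simp

theorem zeta_eq_tsum_dom (f : List Bool →. List Bool) :
    zeta f = ∑' p : dom f, ((appendDigits 1 p : ℕ) : ℝ≥0∞)⁻¹ := by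
  let φ : dom f ≃ Ups (dom f) :=
    { toFun := fun p => ⟨appendDigits 1 p, one_le_appendDigits_one _,
        by rw [bin_appendDigits_one]; exact p.2⟩
      invFun := fun n => ⟨bin n, n.2.2⟩
      left_inv := fun p => Subtype.ext (bin_appendDigits_one _)
      right_inv := fun n => Subtype.ext (appendDigits_one_bin n.2.1) }
  exact (φ.tsum_eq fun n : Ups (dom f) => ((n : ℕ) : ℝ≥0∞)⁻¹).symm

theorem zeta_le_Omega (f : List Bool →. List Bool) : zeta f ≤ Omega f := by
  rw [zeta_eq_tsum_dom, Omega]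
  refine ENNReal.tsum_le_tsum fun p => ?_
  rw [← ENNReal.inv_pow, ENNReal.inv_le_inv]
  have : 2 ^ (p : List Bool).length ≤ appendDigits 1 p := by
    rw [appendDigits_eq]
    omega
  exact_mod_cast this

/-- The dyadic interval of `w` is maximal among those contained in `J`. -/
def IsMaxDyadic (w : List Bool) (J : Set ℝ) : Prop :=
  dyadic w ⊆ J ∧ ∀ u b, w = u ++ [b] → ¬ dyadic u ⊆ J

theorem IsMaxDyadic.eq_of_prefix {u v : List Bool} {J : Set ℝ} (hu : IsMaxDyadic u J)
    (hv : IsMaxDyadic v J) (h : u <+: v) : u = v := by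
  obtain ⟨t, rfl⟩ := h
  obtain rfl | ⟨t, b, rfl⟩ := List.eq_nil_or_concat' t
  · simp
  · exact absurd ((dyadic_append_subset u t).trans hu.1) (hv.2 _ b (by simp))

theorem exists_prefix_isMaxDyadic {w : List Bool} {J : Set ℝ} (h : dyadic w ⊆ J) :
    ∃ u, u <+: w ∧ IsMaxDyadic u J := by
  induction w using List.reverseRecOn with
  | nil => exact ⟨[], List.nil_prefix, h, by simp⟩
  | append_singleton w b ih =>
    by_cases hw : dyadic w ⊆ J
    · obtain ⟨u, hu, hm⟩ := ih hw
      exact ⟨u, hu.trans (List.prefix_append _ _), hm⟩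
    · refine ⟨_, List.prefix_refl _, h, fun u b' hu => ?_⟩
      rwa [← (List.append_inj_left' hu rfl)]

theorem exists_isMaxDyadic_of_mem {a b x : ℝ} {l : ℕ} (hx : x ∈ Set.Ico (0 : ℝ) 1)
    (ha : a ≤ x - (2 ^ l)⁻¹) (hb : x + (2 ^ l)⁻¹ ≤ b) :
    ∃ u, u.length ≤ l ∧ x ∈ dyadic u ∧ IsMaxDyadic u (Set.Ico a b) := by
  obtain ⟨w, rfl, hxw⟩ := exists_length_eq_mem_dyadic l hx
  have hw : dyadic w ⊆ Set.Ico a b := by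
    rw [dyadic_eq_Ico] at hxw
    have := hxw.1
    have := hxw.2
    have e : ((appendDigits 0 w : ℝ) + 1) / 2 ^ w.length =
      appendDigits 0 w / 2 ^ w.length + (2 ^ w.length)⁻¹ := by ring
    rw [dyadic_subset_Ico_iff]
    constructor <;> linarith
  obtain ⟨u, ⟨t, rfl⟩, hu⟩ := exists_prefix_isMaxDyadic hw
  exact ⟨u, by simp, dyadic_append_subset _ _ hxw, hu⟩

section IntervalMachine

variable {e : ℕ → Option (List Bool × List Bool)}

/-- The real number represented by `partialSum e s`. -/
noncomputable def realSum (e : ℕ → Option (List Bool × List Bool)) (s : ℕ) : ℝ :=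
  (partialSum e s).1 / (partialSum e s).2

/-- The interval that the halting event `s` contributes to the sum. -/
noncomputable def eventInterval (e : ℕ → Option (List Bool × List Bool)) (s : ℕ) : Set ℝ :=
  Set.Ico (realSum e s) (realSum e (s + 1))

theorem partialSum_succ_of_none {s : ℕ} (h : e s = none) :
    partialSum e (s + 1) = partialSum e s := by
  simp only [partialSum, h]

theorem partialSum_succ_of_some {s : ℕ} {r : List Bool × List Bool} (h : e s = some r) :
    partialSum e (s + 1) = ((partialSum e s).1 * appendDigits 1 r.1 + (partialSum e s).2,
      (partialSum e s).2 * appendDigits 1 r.1) := by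
  simp only [partialSum, h]

theorem partialSum_snd_pos (e : ℕ → Option (List Bool × List Bool)) (s : ℕ) :
    0 < (partialSum e s).2 := by
  induction s with
  | zero => exact one_pos
  | succ s ih =>
    cases h : e s with
    | none => rwa [partialSum_succ_of_none h]
    | some r =>
      rw [partialSum_succ_of_some h]
      exact Nat.mul_pos ih (one_le_appendDigits_one _)

theorem realSum_zero (e : ℕ → Option (List Bool × List Bool)) : realSum e 0 = 0 := by
  simp [realSum, partialSum]

theorem realSum_succ_of_none {s : ℕ} (h : e s = none) : realSum e (s + 1) = realSum e s := by
  rw [realSum, partialSum_succ_of_none h, realSum]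

theorem realSum_succ_of_some {s : ℕ} {r : List Bool × List Bool} (h : e s = some r) :
    realSum e (s + 1) = realSum e s + (appendDigits 1 r.1 : ℝ)⁻¹ := by
  have h1 : ((partialSum e s).2 : ℝ) ≠ 0 := by exact_mod_cast (partialSum_snd_pos e s).ne'
  have h2 : (appendDigits 1 r.1 : ℝ) ≠ 0 := by
    exact_mod_cast (Nat.one_le_iff_ne_zero.1 (one_le_appendDigits_one r.1))
  rw [realSum, partialSum_succ_of_some h, realSum]
  push_cast
  field_simp

theorem monotone_realSum (e : ℕ → Option (List Bool × List Bool)) : Monotone (realSum e) := by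
  refine monotone_nat_of_le_succ fun s => ?_
  cases h : e s with
  | none => exact (realSum_succ_of_none h).ge
  | some r =>
    rw [realSum_succ_of_some h]
    exact le_add_of_nonneg_right (by positivity)

theorem maxBetween_iff (e : ℕ → Option (List Bool × List Bool)) (w : List Bool) (s : ℕ) :
    maxBetween (partialSum e s) (partialSum e (s + 1)) w = true ↔
      IsMaxDyadic w (eventInterval e s) := by
  have hb : ∀ u, between (partialSum e s) (partialSum e (s + 1)) (appendDigits 0 u) u.length = true
      ↔ dyadic u ⊆ eventInterval e s := by
    intro u
    have h1 : (0 : ℝ) < (partialSum e s).2 := by exact_mod_cast partialSum_snd_pos e s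
    have h2 : (0 : ℝ) < (partialSum e (s + 1)).2 := by
      exact_mod_cast partialSum_snd_pos e (s + 1)
    rw [eventInterval, dyadic_subset_Ico_iff, between, realSum, realSum,
      div_le_div_iff₀ h1 (by positivity), div_le_div_iff₀ (by positivity) h2, Bool.and_eq_true,
      decide_eq_true_iff, decide_eq_true_iff]
    norm_cast
  rw [maxBetween, Bool.and_eq_true, hb, IsMaxDyadic]
  refine and_congr_right fun _ => ?_
  obtain rfl | ⟨u, b, rfl⟩ := List.eq_nil_or_concat' w
  · simp
  · have hu : appendDigits 0 (u ++ [b]) / 2 = appendDigits 0 u := by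
      rw [appendDigits_concat]
      have := b.toNat_le
      omega
    rw [hu, List.length_append, List.length_singleton, Nat.add_sub_cancel, Bool.or_eq_true,
      decide_eq_true_iff, Bool.not_eq_true', ← Bool.not_eq_true, hb]
    constructor
    · rintro (h | h) u' b' h'
      · simp at h
      · rwa [← List.append_inj_left' h' rfl]
    · exact fun h => Or.inr (h u b rfl)

theorem eq_of_mem_eventInterval {x : ℝ} {s s' : ℕ} (h : x ∈ eventInterval e s)
    (h' : x ∈ eventInterval e s') : s = s' := by
  by_contra hne
  exact Set.disjoint_left.1 ((monotone_realSum e).pairwise_disjoint_on_Ico_succ hne) h h'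

theorem IsMaxDyadic.exists_event {w : List Bool} {s : ℕ} (h : IsMaxDyadic w (eventInterval e s)) :
    ∃ p y, e s = some (p, y) := by
  cases hs : e s with
  | some r => exact ⟨r.1, r.2, rfl⟩
  | none =>
    obtain ⟨x, hx⟩ := dyadic_nonempty w
    have := h.1 hx
    rw [eventInterval, realSum_succ_of_none hs, Set.Ico_self] at this
    exact this.elim

theorem mem_eventOutput {w y : List Bool} {s : ℕ} :
    y ∈ eventOutput e w s ↔ IsMaxDyadic w (eventInterval e s) ∧ ∃ p, e s = some (p, y) := by
  rw [← maxBetween_iff, eventOutput]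
  cases maxBetween (partialSum e s) (partialSum e (s + 1)) w <;> simp

theorem mem_intervalMachine {w y : List Bool} :
    y ∈ intervalMachine e w ↔
      ∃ s p, IsMaxDyadic w (eventInterval e s) ∧ e s = some (p, y) := by
  constructor
  · intro h
    obtain ⟨s, hs⟩ := Nat.rfindOpt_spec h
    obtain ⟨hw, p, hp⟩ := mem_eventOutput.1 hs
    exact ⟨s, p, hw, hp⟩
  · rintro ⟨s, p, hw, hp⟩
    have hd : (intervalMachine e w).Dom :=
      Nat.rfindOpt_dom.2 ⟨s, y, mem_eventOutput.2 ⟨hw, p, hp⟩⟩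
    obtain ⟨z, hz⟩ := Part.dom_iff_mem.1 hd
    obtain ⟨s', hs'⟩ := Nat.rfindOpt_spec hz
    obtain ⟨hw', p', hp'⟩ := mem_eventOutput.1 hs'
    obtain ⟨x, hx⟩ := dyadic_nonempty w
    obtain rfl := eq_of_mem_eventInterval (hw.1 hx) (hw'.1 hx)
    rw [hp] at hp'
    cases hp'
    exact hz

theorem mem_dom_intervalMachine {w : List Bool} :
    w ∈ dom (intervalMachine e) ↔ ∃ s, IsMaxDyadic w (eventInterval e s) := by
  refine Part.dom_iff_mem.trans ⟨?_, ?_⟩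
  · rintro ⟨y, hy⟩
    obtain ⟨s, p, h, -⟩ := mem_intervalMachine.1 hy
    exact ⟨s, h⟩
  · rintro ⟨s, h⟩
    obtain ⟨p, y, hs⟩ := h.exists_event
    exact ⟨y, mem_intervalMachine.2 ⟨s, p, h, hs⟩⟩

theorem selfDelim_intervalMachine (e : ℕ → Option (List Bool × List Bool)) :
    SelfDelim (intervalMachine e) := by
  intro u hu v hv huv
  obtain ⟨s, hs⟩ := mem_dom_intervalMachine.1 hu
  obtain ⟨s', hs'⟩ := mem_dom_intervalMachine.1 hv
  obtain ⟨x, hx⟩ := dyadic_nonempty v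
  have hxu : x ∈ dyadic u := by
    obtain ⟨t, rfl⟩ := huv
    exact dyadic_append_subset u t hx
  obtain rfl := eq_of_mem_eventInterval (hs.1 hxu) (hs'.1 hx)
  exact hs.eq_of_prefix hs' huv

variable {V : List Bool →. List Bool}

theorem Enumerates.zeta_eq_tsum (he : Enumerates e V) :
    zeta V = ∑' s, ENNReal.ofReal (realSum e (s + 1) - realSum e s) := by
  have hex : ∀ p : dom V, ∃ s y, e s = some (p.1, y) := fun p => by
    obtain ⟨y, hy⟩ := Part.dom_iff_mem.1 p.2
    obtain ⟨s, hs⟩ := he.exists_of_mem hy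
    exact ⟨s, y, hs⟩
  choose g y hg using hex
  have hinj : Function.Injective g := by
    intro p q hpq
    have := hg p
    rw [hpq, hg q] at this
    simp only [Option.some_inj, Prod.mk.injEq] at this
    exact Subtype.ext this.1.symm
  rw [zeta_eq_tsum_dom, ← hinj.tsum_eq]
  · refine tsum_congr fun p => ?_
    rw [realSum_succ_of_some (hg p), add_sub_cancel_left, ENNReal.ofReal_inv_of_pos
      (by exact_mod_cast one_le_appendDigits_one _), ENNReal.ofReal_natCast]
  · intro s hs
    cases h : e s with
    | none => simp [realSum_succ_of_none h] at hs
    | some r =>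
      have hr : r.1 ∈ dom V := Part.dom_iff_mem.2 ⟨r.2, he.mem h⟩
      exact ⟨⟨r.1, hr⟩, he.inj (hg ⟨r.1, hr⟩) h⟩

theorem Enumerates.realSum_le_one (he : Enumerates e V) (hV : zeta V ≤ 1) (s : ℕ) :
    realSum e s ≤ 1 := by
  have h : ENNReal.ofReal (realSum e s) ≤ 1 := by
    calc ENNReal.ofReal (realSum e s)
        = ∑ i ∈ Finset.range s, ENNReal.ofReal (realSum e (i + 1) - realSum e i) := by
          rw [← ENNReal.ofReal_sum_of_nonneg fun i _ =>
            sub_nonneg.2 (monotone_realSum e (Nat.le_succ i)), Finset.sum_range_sub, realSum_zero,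
            sub_zero]
      _ ≤ zeta V := by
          rw [he.zeta_eq_tsum]
          exact ENNReal.sum_le_tsum _
      _ ≤ 1 := hV
  exact ENNReal.ofReal_le_one.1 h

theorem Enumerates.exists_isMaxDyadic (he : Enumerates e V) (hV : zeta V ≤ 1) {s l : ℕ} {x : ℝ}
    (h1 : realSum e s ≤ x - (2 ^ l)⁻¹) (h2 : x + (2 ^ l)⁻¹ ≤ realSum e (s + 1)) :
    ∃ u, u.length ≤ l ∧ x ∈ dyadic u ∧ IsMaxDyadic u (eventInterval e s) := by
  have hl : (0 : ℝ) < (2 ^ l)⁻¹ := by positivity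
  have h0 : 0 ≤ realSum e s := realSum_zero e ▸ monotone_realSum e (Nat.zero_le s)
  have := he.realSum_le_one hV (s + 1)
  exact exists_isMaxDyadic_of_mem ⟨by linarith, by linarith⟩ h1 h2

theorem Enumerates.Omega_intervalMachine (he : Enumerates e V) (hV : zeta V ≤ 1) :
    Omega (intervalMachine e) = zeta V := by
  rw [Omega_eq_volume (selfDelim_intervalMachine e), he.zeta_eq_tsum]
  apply le_antisymm
  · calc _ ≤ MeasureTheory.volume (⋃ s, eventInterval e s) := by
          refine MeasureTheory.measure_mono (Set.iUnion₂_subset fun w hw => ?_)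
          obtain ⟨s, hs⟩ := mem_dom_intervalMachine.1 hw
          exact hs.1.trans (Set.subset_iUnion _ s)
      _ ≤ ∑' s, MeasureTheory.volume (eventInterval e s) := MeasureTheory.measure_iUnion_le _
      _ = _ := by simp only [eventInterval, Real.volume_Ico]
  · calc _ = ∑' s, MeasureTheory.volume (Set.Ioo (realSum e s) (realSum e (s + 1))) := by
          simp only [Real.volume_Ioo]
      _ = MeasureTheory.volume (⋃ s, Set.Ioo (realSum e s) (realSum e (s + 1))) :=
          (MeasureTheory.measure_iUnion (monotone_realSum e).pairwise_disjoint_on_Ioo_succ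
            fun _ => measurableSet_Ioo).symm
      _ ≤ _ := by
          refine MeasureTheory.measure_mono (Set.iUnion_subset fun s x hx => ?_)
          obtain ⟨l, hl⟩ := exists_pow_lt_of_lt_one
            (lt_min (sub_pos.2 hx.1) (sub_pos.2 hx.2)) (show (2 : ℝ)⁻¹ < 1 by norm_num)
          rw [inv_pow, lt_min_iff] at hl
          obtain ⟨u, -, hxu, hu⟩ := he.exists_isMaxDyadic hV (s := s) (x := x) (l := l)
            (by linarith) (by linarith)
          exact Set.mem_biUnion (mem_dom_intervalMachine.2 ⟨s, hu⟩) hxu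

theorem Enumerates.exists_program (he : Enumerates e V) (hV : zeta V ≤ 1) {p : List Bool}
    (hp : p ∈ dom V) : ∃ w, w.length ≤ p.length + 2 ∧ intervalMachine e w = V p := by
  obtain ⟨y, hy⟩ := Part.dom_iff_mem.1 hp
  obtain ⟨s, hs⟩ := he.exists_of_mem hy
  have hlen : 2 * ((2 : ℝ) ^ (p.length + 2))⁻¹ ≤ (appendDigits 1 p : ℝ)⁻¹ := by
    have h1 : appendDigits 1 p ≤ 2 ^ (p.length + 1) := by
      rw [appendDigits_eq, pow_succ]
      have := appendDigits_zero_lt p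
      omega
    have h2 : (0 : ℝ) < appendDigits 1 p := by exact_mod_cast one_le_appendDigits_one p
    calc 2 * ((2 : ℝ) ^ (p.length + 2))⁻¹ = ((2 : ℝ) ^ (p.length + 1))⁻¹ := by
          rw [pow_succ _ (p.length + 1)]
          field_simp
      _ ≤ _ := inv_anti₀ h2 (by exact_mod_cast h1)
  have hstep := realSum_succ_of_some hs
  obtain ⟨w, hw, -, hm⟩ := he.exists_isMaxDyadic hV (s := s) (l := p.length + 2)
    (x := realSum e s + (2 ^ (p.length + 2))⁻¹) (by simp) (by linarith)
  exact ⟨w, hw, (Part.eq_some_iff.2 (mem_intervalMachine.2 ⟨s, p, hm, hs⟩)).trans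
    (Part.eq_some_iff.2 hy).symm⟩

end IntervalMachine

/-- For each tuatara machine `V` there is a self-delimiting machine `C` with
`Ω_C = ζ_V`; if `V` is a universal tuatara machine, `C` can be chosen to be a
universal self-delimiting machine. -/
theorem stmt_6 (V : List Bool →. List Bool) (hV : Partrec V) (htua : zeta V ≤ 1) :
    (∃ C : List Bool →. List Bool, Partrec C ∧ SelfDelim C ∧ Omega C = zeta V) ∧
    (UnivTuatara V →
      ∃ C : List Bool →. List Bool, Partrec C ∧ UnivSD C ∧ Omega C = zeta V) := by
  obtain ⟨e, hcomp, he⟩ := exists_computable_enumerates hV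
  have hP := partrec_intervalMachine hcomp
  have hO := he.Omega_intervalMachine htua
  have hS := selfDelim_intervalMachine e
  refine ⟨⟨_, hP, hS, hO⟩, fun hU => ⟨_, hP, ⟨hS, fun C hC hCS => ?_⟩, hO⟩⟩
  obtain ⟨c, hc⟩ := hU.2 C hC ((zeta_le_Omega C).trans (Omega_le_one hCS))
  refine ⟨c + 2, fun x hx => ?_⟩
  obtain ⟨p, hp, hpx⟩ := hc x hx
  have hpd : p ∈ dom V := by
    change (V p).Dom
    rw [hpx]
    exact hx
  obtain ⟨w, hw, hwp⟩ := he.exists_program htua hpd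
  exact ⟨w, by omega, hwp.trans hpx⟩
end

section
/- For every computable real s > 1 and every universal Turing machine T, the real ⟨κ_T⟩(s) = (1 − 2^{−s+1})·∑_{p ∈ dom(T)} 2^{−s|p|} is 1/s-K-random: for every binary digit sequence x : ℕ → Bool with ⟨κ_T⟩(s) = ∑_{i≥0} (x i)·2^{-(i+1)}, there exists a constant c ≥ 0 such that for all m ≥ 1, K_T(x_0 ⋯ x_{m−1}) ≥ m/s − c. -/
open scoped ENNReal

/-- The halting probability of `T` at `s`:
`⟨κ_T⟩(s) = (1 − 2^{−s+1})·∑_{p ∈ dom T} 2^{−s|p|}`. -/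
noncomputable def kappa (T : List Bool →. List Bool) (s : ℝ) : ℝ :=
  (1 - (2 : ℝ) ^ (-s + 1)) * ∑' p : dom T, (2 : ℝ) ^ (-(s * ((p : List Bool).length : ℝ)))

section RatEncoding

open Encodable Denumerable

theorem ofEncodableOfInfinite_ofNat_strictMono {α : Type*} [e : Encodable α] [Infinite α] :
    StrictMono fun k => e.encode ((Denumerable.ofEncodableOfInfinite α).ofNat α k) := by
  let := @decidableRangeEncode α _
  let : Infinite (Set.range (@encode α _)) :=
    Infinite.of_injective _ (Equiv.ofInjective _ encode_injective).injective
  have h : ∀ k, e.encode ((Denumerable.ofEncodableOfInfinite α).ofNat α k) =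
      (Nat.Subtype.ofNat (Set.range (@encode α _)) k : ℕ) := by
    intro k
    let := Nat.Subtype.denumerable (Set.range (@encode α _))
    have h1 : (Denumerable.ofEncodableOfInfinite α).ofNat α k =
        (equivRangeEncode α).symm (ofNat (Set.range (@encode α _)) k) :=
      ofEquiv_ofNat (Set.range (@encode α _)) (equivRangeEncode α) k
    have h2 : ofNat (Set.range (@encode α _)) k = Nat.Subtype.ofNat (Set.range (@encode α _)) k :=
      ofEquiv_ofNat ℕ (β := Set.range (@encode α _)) _ k
    rw [h1, h2]
    exact congrArg Subtype.val ((equivRangeEncode α).apply_symm_apply _)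
  simp only [h]
  exact strictMono_nat_of_lt_succ fun n => Nat.Subtype.lt_succ_self _

theorem Rat.encode_eq_pair (q : ℚ) :
    Rat.instEncodable.encode q = Nat.pair (Equiv.intEquivNat q.num) q.den := rfl

theorem intEquivNat_natCast (a : ℕ) : Equiv.intEquivNat (a : ℤ) = 2 * a := rfl

theorem intEquivNat_negSucc (a : ℕ) : Equiv.intEquivNat (Int.negSucc a) = 2 * a + 1 := rfl

theorem Int.natAbs_eq_intEquivNat (a : ℤ) : a.natAbs = (Equiv.intEquivNat a + 1) / 2 := by
  cases a with
  | ofNat a => rw [Int.ofNat_eq_natCast, intEquivNat_natCast]; simp; omega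
  | negSucc a => rw [intEquivNat_negSucc]; simp; omega

theorem Int.toNat_eq_intEquivNat (a : ℤ) : a.toNat =
    if Equiv.intEquivNat a % 2 = 0 then Equiv.intEquivNat a / 2 else 0 := by
  cases a with
  | ofNat a => rw [Int.ofNat_eq_natCast, intEquivNat_natCast]; simp
  | negSucc a => rw [intEquivNat_negSucc]; simp

theorem Rat.mem_range_encode (j : ℕ) : j ∈ Set.range Rat.instEncodable.encode ↔
    0 < j.unpair.2 ∧ Nat.Coprime ((j.unpair.1 + 1) / 2) j.unpair.2 := by
  constructor
  · rintro ⟨q, rfl⟩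
    rw [Rat.encode_eq_pair, Nat.unpair_pair, ← Int.natAbs_eq_intEquivNat]
    exact ⟨q.pos, q.reduced⟩
  · rintro ⟨h1, h2⟩
    refine ⟨⟨Equiv.intEquivNat.symm j.unpair.1, j.unpair.2, h1.ne', ?_⟩, ?_⟩
    · rw [Int.natAbs_eq_intEquivNat, Equiv.apply_symm_apply]; exact h2
    · rw [Rat.encode_eq_pair]; simp

theorem primrecRel_dvd : PrimrecRel fun a b : ℕ => a ∣ b :=
  (Primrec.eq.comp (Primrec.nat_mod.comp Primrec.snd Primrec.fst) (Primrec.const 0)).of_eq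
    fun p => (Nat.dvd_iff_mod_eq_zero (m := p.1) (n := p.2)).symm

theorem primrecRel_coprime : PrimrecRel fun a b : ℕ => 0 < b ∧ Nat.Coprime a b := by
  have hp : PrimrecRel fun (k : ℕ) (ab : ℕ × ℕ) => ¬ (k ∣ ab.1 ∧ k ∣ ab.2) ∨ k = 1 :=
    (((primrecRel_dvd.comp Primrec.fst (Primrec.fst.comp Primrec.snd)).and
      (primrecRel_dvd.comp Primrec.fst (Primrec.snd.comp Primrec.snd))).not).or
      (Primrec.eq.comp Primrec.fst (Primrec.const 1))
  have h1 : PrimrecPred fun ab : ℕ × ℕ => 0 < ab.2 ∧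
      ∀ a ∈ List.range (ab.2 + 1), ¬ (a ∣ ab.1 ∧ a ∣ ab.2) ∨ a = 1 :=
    (Primrec.nat_lt.comp (Primrec.const 0) Primrec.snd).and
      (hp.forall_mem_list.comp (Primrec.list_range.comp (Primrec.succ.comp Primrec.snd))
        Primrec.id)
  refine (h1.of_eq fun ab => and_congr_right fun h0 => ?_)
  constructor
  · intro h
    have := h (Nat.gcd ab.1 ab.2) (List.mem_range.2
      (Nat.lt_succ_of_le (Nat.le_of_dvd h0 (Nat.gcd_dvd_right _ _))))
    simpa [Nat.gcd_dvd_left, Nat.gcd_dvd_right] using this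
  · intro h a _
    by_cases h' : a ∣ ab.1 ∧ a ∣ ab.2
    · exact Or.inr (Nat.eq_one_of_dvd_coprimes h h'.1 h'.2)
    · exact Or.inl h'

theorem Primrec.nat_count {p : ℕ → Prop} [DecidablePred p] (hp : PrimrecPred p) :
    Primrec (Nat.count p) := by
  have : Primrec (Nat.rec 0 fun n c => if p n then c + 1 else c : ℕ → ℕ) :=
    Primrec.nat_rec₁ 0 (Primrec.ite (hp.comp Primrec.fst)
      (Primrec.succ.comp Primrec.snd) Primrec.snd)
  refine this.of_eq fun n => ?_
  induction n with
  | zero => simp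
  | succ n ih =>
    rw [Nat.count_succ, ← ih]
    by_cases h : p n <;> simp [h]

/-- Numerator and denominator can be computed from the code of a rational. -/
theorem Rat.computable_num_den :
    Computable fun q : ℚ => (q.num.toNat, q.den) := by
  classical
  set φ : ℕ → ℕ := fun k => Rat.instEncodable.encode (ofNat ℚ k) with hφ
  have hmono : StrictMono φ := ofEncodableOfInfinite_ofNat_strictMono
  set R : ℕ → Prop := fun j => 0 < j.unpair.2 ∧ Nat.Coprime ((j.unpair.1 + 1) / 2) j.unpair.2
    with hR
  have hRange : ∀ j, R j ↔ ∃ k, φ k = j := by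
    intro j
    refine (Rat.mem_range_encode j).symm.trans ?_
    constructor
    · rintro ⟨q, rfl⟩
      exact ⟨Rat.instDenumerable.encode q, congrArg Rat.instEncodable.encode (ofNat_encode q)⟩
    · rintro ⟨k, rfl⟩
      exact ⟨_, rfl⟩
  have hRp : PrimrecPred R := primrecRel_coprime.comp
    (Primrec.nat_div.comp (Primrec.succ.comp (Primrec.fst.comp Primrec.unpair)) (Primrec.const 2))
    (Primrec.snd.comp Primrec.unpair)
  have hcount : ∀ k, Nat.count R (φ k) = k := by
    intro k
    rw [Nat.count_eq_card_filter_range]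
    have : (Finset.range (φ k)).filter R = (Finset.range k).image φ := by
      ext j
      simp only [Finset.mem_filter, Finset.mem_range, Finset.mem_image, hRange]
      constructor
      · rintro ⟨h, i, rfl⟩
        exact ⟨i, hmono.lt_iff_lt.1 h, rfl⟩
      · rintro ⟨i, h, rfl⟩
        exact ⟨hmono h, i, rfl⟩
    rw [this, Finset.card_image_of_injective _ hmono.injective, Finset.card_range]
  have hφc : Computable φ := by
    have hs : Partrec fun k : ℕ => Nat.rfind fun j =>
        (Part.some (decide (R j ∧ Nat.count R j = k)) : Part Bool) := by
      refine Partrec.rfind (Computable.partrec ?_)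
      exact ((hRp.comp Primrec.snd).and (Primrec.eq.comp
        ((Primrec.nat_count hRp).comp Primrec.snd) Primrec.fst)).decide.to_comp
    refine hs.of_eq_tot fun k => ?_
    refine Nat.mem_rfind.2 ⟨by simpa [hcount k] using (hRange _).2 ⟨k, rfl⟩, fun {m} hm => ?_⟩
    simp only [Part.mem_some_iff, Bool.false_eq, decide_eq_false_iff_not, not_and]
    intro h
    obtain ⟨i, rfl⟩ := (hRange m).1 h
    rw [hcount]
    exact (hmono.lt_iff_lt.1 hm).ne
  have hfin : Primrec fun j : ℕ =>
      (if j.unpair.1 % 2 = 0 then j.unpair.1 / 2 else 0, j.unpair.2) := by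
    have h1 : Primrec fun j : ℕ => j.unpair.1 := Primrec.fst.comp Primrec.unpair
    exact (Primrec.ite (Primrec.eq.comp (Primrec.nat_mod.comp h1 (Primrec.const 2))
      (Primrec.const 0)) (Primrec.nat_div.comp h1 (Primrec.const 2)) (Primrec.const 0)).pair
      (Primrec.snd.comp Primrec.unpair)
  refine (hfin.to_comp.comp (hφc.comp Computable.encode)).of_eq fun q => ?_
  simp only [hφ, ofNat_encode, Rat.encode_eq_pair, Nat.unpair_pair, ← Int.toNat_eq_intEquivNat]

end RatEncoding

/-- The numerator of the best lower approximation of `2 ^ (-(U / V))` with denominator `2 ^ n`. -/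
def powFloor (n U V : ℕ) : ℕ :=
  Nat.findGreatest (fun L => L ^ V * 2 ^ U ≤ 2 ^ (n * V)) (2 ^ n)

theorem Primrec.nat_pow : Primrec₂ ((· ^ ·) : ℕ → ℕ → ℕ) :=
  Primrec₂.unpaired'.1 Nat.Primrec.pow

theorem Primrec.powFloor : Primrec fun t : ℕ × ℕ × ℕ => powFloor t.1 t.2.1 t.2.2 := by
  have hn : Primrec fun t : ℕ × ℕ × ℕ => t.1 := Primrec.fst
  have hU : Primrec fun t : ℕ × ℕ × ℕ => t.2.1 := Primrec.fst.comp Primrec.snd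
  have hV : Primrec fun t : ℕ × ℕ × ℕ => t.2.2 := Primrec.snd.comp Primrec.snd
  have h2 {α : Type} [Primcodable α] : Primrec fun _ : α => 2 := Primrec.const 2
  refine Primrec.nat_findGreatest (Primrec.nat_pow.comp h2 hn)
    (p := fun t L => L ^ t.2.2 * 2 ^ t.2.1 ≤ 2 ^ (t.1 * t.2.2)) ?_
  exact Primrec.nat_le.comp
    (Primrec.nat_mul.comp (Primrec.nat_pow.comp Primrec.snd (hV.comp Primrec.fst))
      (Primrec.nat_pow.comp h2 (hU.comp Primrec.fst)))
    (Primrec.nat_pow.comp h2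
      (Primrec.nat_mul.comp (hn.comp Primrec.fst) (hV.comp Primrec.fst)))

theorem pow_mul_le_iff_div_le (n U V L : ℕ) (hV : 0 < V) :
    L ^ V * 2 ^ U ≤ 2 ^ (n * V) ↔ (L : ℝ) / 2 ^ n ≤ (2 : ℝ) ^ (-((U : ℝ) / V)) := by
  have ht : (0 : ℝ) ≤ (2 : ℝ) ^ (-((U : ℝ) / V)) := by positivity
  have htV : ((2 : ℝ) ^ (-((U : ℝ) / V))) ^ V = ((2 : ℝ) ^ U)⁻¹ := by
    have hV' : (V : ℝ) ≠ 0 := by positivity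
    rw [← Real.rpow_natCast, ← Real.rpow_mul (by norm_num), neg_mul, div_mul_cancel₀ _ hV',
      Real.rpow_neg (by norm_num), Real.rpow_natCast]
  rw [← pow_le_pow_iff_left₀ (by positivity) ht hV.ne', htV, div_pow, ← pow_mul,
    div_le_iff₀ (by positivity), inv_mul_eq_div, le_div_iff₀ (by positivity)]
  exact_mod_cast Iff.rfl

theorem powFloor_le (n U V : ℕ) (hV : 0 < V) :
    (powFloor n U V : ℝ) / 2 ^ n ≤ (2 : ℝ) ^ (-((U : ℝ) / V)) := by
  rw [← pow_mul_le_iff_div_le n U V _ hV]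
  exact Nat.findGreatest_spec (P := fun L => L ^ V * 2 ^ U ≤ 2 ^ (n * V)) (Nat.zero_le _)
    (by simp [hV.ne'])

theorem lt_powFloor_add_one (n U V : ℕ) (hV : 0 < V) :
    (2 : ℝ) ^ (-((U : ℝ) / V)) < (powFloor n U V : ℝ) / 2 ^ n + (2 : ℝ)⁻¹ ^ n := by
  have he : (powFloor n U V : ℝ) / 2 ^ n + (2 : ℝ)⁻¹ ^ n =
      ((powFloor n U V + 1 : ℕ) : ℝ) / 2 ^ n := by
    rw [inv_pow]; push_cast; ring
  rw [he]
  by_cases h : powFloor n U V + 1 ≤ 2 ^ n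
  · have := Nat.findGreatest_is_greatest (P := fun L => L ^ V * 2 ^ U ≤ 2 ^ (n * V))
      (Nat.lt_succ_self (powFloor n U V)) h
    rw [pow_mul_le_iff_div_le n U V _ hV] at this
    exact not_le.1 this
  · have h1 : (2 : ℝ) ^ (-((U : ℝ) / V)) ≤ 1 :=
      Real.rpow_le_one_of_one_le_of_nonpos (by norm_num) (by
        have : (0 : ℝ) ≤ (U : ℝ) / V := by positivity
        linarith)
    refine h1.trans_lt ?_
    rw [lt_div_iff₀ (by positivity), one_mul]
    exact_mod_cast not_le.1 h

/-- For a computable real `s > 0`, the real `2 ^ (-s)` has computable lower and upper dyadic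
approximations. -/
theorem ComputableReal.exists_dyadic_bounds {s : ℝ} (hs : ComputableReal s) (h0 : 0 < s) :
    ∃ lo hi : ℕ → ℕ, Computable lo ∧ Computable hi ∧
      (∀ n, (lo n : ℝ) / 2 ^ n ≤ (2 : ℝ) ^ (-s)) ∧ (∀ n, (2 : ℝ) ^ (-s) ≤ (hi n : ℝ) / 2 ^ n) ∧
      Filter.Tendsto (fun n => (lo n : ℝ) / 2 ^ n) Filter.atTop (nhds ((2 : ℝ) ^ (-s))) ∧
      Filter.Tendsto (fun n => (hi n : ℝ) / 2 ^ n) Filter.atTop (nhds ((2 : ℝ) ^ (-s))) := by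
  obtain ⟨f, hf, hfs⟩ := hs
  set N : ℕ → ℕ := fun n => (f n).num.toNat with hN
  set D : ℕ → ℕ := fun n => (f n).den with hD
  have hND : Computable fun n => (N n, D n) := Rat.computable_num_den.comp hf
  have hD0 : ∀ n, 0 < D n := fun n => (f n).pos
  have hclose : ∀ n, |s - (N n : ℝ) / D n| ≤ (2 : ℝ)⁻¹ ^ n := by
    intro n
    refine le_trans ?_ (hfs n)
    rcases le_total 0 (f n) with h | h
    · have h1 : ((f n : ℚ) : ℝ) = (N n : ℝ) / D n := by
        conv_lhs => rw [← Rat.num_div_den (f n)]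
        have h2 : ((N n : ℕ) : ℤ) = (f n).num := Int.toNat_of_nonneg (Rat.num_nonneg.2 h)
        rw [← h2]
        simp [hD]
      rw [h1]
    · have h1 : N n = 0 := Int.toNat_eq_zero.2 (Rat.num_nonpos.2 h)
      have h2 : ((f n : ℚ) : ℝ) ≤ 0 := by exact_mod_cast h
      rw [h1, Nat.cast_zero, zero_div, sub_zero, abs_of_pos h0, abs_of_nonneg (by linarith)]
      linarith
  set U : ℕ → ℕ := fun n => N n * 2 ^ n + D n with hU
  set U' : ℕ → ℕ := fun n => N n * 2 ^ n - D n with hU'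
  set V : ℕ → ℕ := fun n => D n * 2 ^ n with hV
  have hV0 : ∀ n, 0 < V n := fun n => Nat.mul_pos (hD0 n) (by positivity)
  have hUV : ∀ n, (U n : ℝ) / V n = (N n : ℝ) / D n + (2 : ℝ)⁻¹ ^ n := by
    intro n
    have := hD0 n
    simp only [hU, hV, inv_pow]
    push_cast
    field_simp
  have hUV' : ∀ n, (U' n : ℝ) / V n = max 0 ((N n : ℝ) / D n - (2 : ℝ)⁻¹ ^ n) := by
    intro n
    have hDn : (0 : ℝ) < D n := by exact_mod_cast hD0 n
    have hc : (N n : ℝ) / D n - (2 : ℝ)⁻¹ ^ n = ((N n * 2 ^ n : ℝ) - D n) / V n := by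
      simp only [hV, inv_pow]
      push_cast
      field_simp
    have hVn : (0 : ℝ) < V n := by exact_mod_cast hV0 n
    rw [hc]
    rcases le_total (D n) (N n * 2 ^ n) with h | h
    · have h' : (D n : ℝ) ≤ N n * 2 ^ n := by exact_mod_cast h
      rw [max_eq_right (div_nonneg (by linarith) hVn.le)]
      simp only [hU']
      push_cast [Nat.cast_sub h]
      rfl
    · have h' : (N n * 2 ^ n : ℝ) ≤ D n := by exact_mod_cast h
      rw [max_eq_left (div_nonpos_of_nonpos_of_nonneg (by linarith) hVn.le)]
      simp [hU', Nat.sub_eq_zero_of_le h]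
  have hpow : Filter.Tendsto (fun n : ℕ => (2 : ℝ)⁻¹ ^ n) Filter.atTop (nhds 0) :=
    tendsto_pow_atTop_nhds_zero_of_lt_one (by norm_num) (by norm_num)
  have hlims : Filter.Tendsto (fun n => (N n : ℝ) / D n) Filter.atTop (nhds s) := by
    rw [tendsto_iff_dist_tendsto_zero]
    refine squeeze_zero (fun _ => dist_nonneg) (fun n => ?_) hpow
    rw [dist_comm]
    exact hclose n
  have hlimU : Filter.Tendsto (fun n => (U n : ℝ) / V n) Filter.atTop (nhds s) := by
    simp only [hUV]
    simpa using hlims.add hpow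
  have hlimU' : Filter.Tendsto (fun n => (U' n : ℝ) / V n) Filter.atTop (nhds s) := by
    simp only [hUV']
    have := (tendsto_const_nhds (x := (0 : ℝ))).max (hlims.sub hpow)
    simpa [max_eq_right h0.le] using this
  have hexp : Continuous fun t : ℝ => (2 : ℝ) ^ (-t) :=
    (Real.continuous_const_rpow (by norm_num)).comp continuous_neg
  have htU := (hexp.tendsto s).comp hlimU
  have htU' := (hexp.tendsto s).comp hlimU'
  have hle : ∀ n, (2 : ℝ) ^ (-((U n : ℝ) / V n)) ≤ (2 : ℝ) ^ (-s) := by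
    intro n
    refine Real.rpow_le_rpow_of_exponent_le (by norm_num) ?_
    have := (abs_le.1 (hclose n)).2
    rw [hUV]; linarith
  have hge : ∀ n, (2 : ℝ) ^ (-s) ≤ (2 : ℝ) ^ (-((U' n : ℝ) / V n)) := by
    intro n
    refine Real.rpow_le_rpow_of_exponent_le (by norm_num) ?_
    have := (abs_le.1 (hclose n)).1
    rw [hUV']
    exact neg_le_neg (max_le h0.le (by linarith))
  have hNc : Computable N := Computable.fst.comp hND
  have hDc : Computable D := Computable.snd.comp hND
  have h2c : Computable fun n : ℕ => 2 ^ n :=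
    (Primrec.nat_pow.comp (Primrec.const 2) Primrec.id).to_comp
  have hmul := Primrec.nat_mul.to_comp
  have hVc : Computable V := hmul.comp hDc h2c
  have hUc : Computable U := Primrec.nat_add.to_comp.comp (hmul.comp hNc h2c) hDc
  have hUc' : Computable U' := Primrec.nat_sub.to_comp.comp (hmul.comp hNc h2c) hDc
  refine ⟨fun n => powFloor n (U n) (V n), fun n => powFloor n (U' n) (V n) + 1,
    Primrec.powFloor.to_comp.comp (Computable.id.pair (hUc.pair hVc)),
    Computable.succ.comp (Primrec.powFloor.to_comp.comp (Computable.id.pair (hUc'.pair hVc))),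
    fun n => (powFloor_le n _ _ (hV0 n)).trans (hle n), fun n => ?_, ?_, ?_⟩
  · have := lt_powFloor_add_one n (U' n) (V n) (hV0 n)
    refine (hge n).trans (this.le.trans (le_of_eq ?_))
    rw [inv_pow]; push_cast; ring
  · refine tendsto_of_tendsto_of_tendsto_of_le_of_le (g := fun n =>
      (2 : ℝ) ^ (-((U n : ℝ) / V n)) - (2 : ℝ)⁻¹ ^ n) (by simpa using! htU.sub hpow) htU
      (fun n => ?_) (fun n => powFloor_le n _ _ (hV0 n))
    have := lt_powFloor_add_one n (U n) (V n) (hV0 n)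
    simp only
    linarith
  · refine tendsto_of_tendsto_of_tendsto_of_le_of_le (h := fun n =>
      (2 : ℝ) ^ (-((U' n : ℝ) / V n)) + (2 : ℝ)⁻¹ ^ n) htU' (by simpa using! htU'.add hpow)
      (fun n => ?_) (fun n => ?_)
    · have := lt_powFloor_add_one n (U' n) (V n) (hV0 n)
      refine this.le.trans (le_of_eq ?_)
      simp only [inv_pow]; push_cast; ring
    · have := powFloor_le n (U' n) (V n) (hV0 n)
      have e : ((powFloor n (U' n) (V n) + 1 : ℕ) : ℝ) / 2 ^ n =
        (powFloor n (U' n) (V n) : ℝ) / 2 ^ n + (2 : ℝ)⁻¹ ^ n := by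
        rw [inv_pow]; push_cast; ring
      simp only [e]
      linarith

section Stages

open Encodable

/-- A computable enumeration of the graph of a partial computable function on strings by finite
stages. -/
theorem Partrec.exists_stages_s12 {T : List Bool →. List Bool} (hT : Partrec T) :
    ∃ st : ℕ → List (List Bool × List Bool), Computable st ∧
      (∀ n, ((st n).map Prod.fst).Nodup) ∧
      (∀ n, ∀ e ∈ st n, e.2 ∈ T e.1 ∧ e.1.length ≤ n) ∧
      ∀ p y, y ∈ T p → ∀ᶠ n in Filter.atTop, (p, y) ∈ st n := by
  obtain ⟨c, hc⟩ := Nat.Partrec.Code.exists_code.1 hT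
  have heval : ∀ p v, v ∈ c.eval (encode p) ↔ ∃ y ∈ T p, encode y = v := by
    intro p v
    rw [hc]
    simp
  set E : ℕ → ℕ → Option (List Bool × List Bool) := fun n i =>
    (decode₂ (List Bool) i).bind fun p =>
      if p.length ≤ n then (c.evaln n i).bind fun v =>
        (decode v : Option (List Bool)).map fun y => (p, y) else Option.none with hE
  have hEp : Primrec₂ E := by
    refine Primrec.option_bind (Primrec.decode₂.comp Primrec.snd) ?_
    refine Primrec.ite (Primrec.nat_le.comp (Primrec.list_length.comp Primrec.snd)
      (Primrec.fst.comp Primrec.fst)) ?_ (Primrec.const Option.none)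
    refine Primrec.option_bind (Nat.Partrec.Code.primrec_evaln.comp
      (((Primrec.fst.comp Primrec.fst).pair (Primrec.const c)).pair
        (Primrec.snd.comp Primrec.fst))) ?_
    exact Primrec.option_map (Primrec.decode.comp Primrec.snd)
      (Primrec.pair (Primrec.snd.comp (Primrec.fst.comp Primrec.fst)) Primrec.snd)
  have hEmem : ∀ n i p y, (p, y) ∈ E n i →
      encode p = i ∧ y ∈ T p ∧ p.length ≤ n := by
    intro n i p y h
    simp only [hE, Option.mem_def, Option.bind_eq_some_iff] at h
    obtain ⟨p', hp', h⟩ := h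
    split_ifs at h with hl
    simp only [Option.bind_eq_some_iff, Option.map_eq_some_iff, Prod.mk.injEq] at h
    obtain ⟨v, hv, y', hy', rfl, rfl⟩ := h
    obtain rfl : encode p' = i := mem_decode₂.1 hp'
    obtain ⟨y, hy, rfl⟩ := (heval _ _).1 (Nat.Partrec.Code.evaln_sound hv)
    rw [encodek, Option.some_inj] at hy'
    subst hy'
    exact ⟨rfl, hy, hl⟩
  refine ⟨fun n => (List.range n).filterMap (E n),
    (Primrec.listFilterMap Primrec.list_range hEp).to_comp, fun n => ?_, fun n e he => ?_,
    fun p y hy => ?_⟩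
  · rw [List.map_filterMap]
    refine List.nodup_range.filterMap fun i j p hi hj => ?_
    simp only [Option.mem_def, Option.map_eq_some_iff] at hi hj
    obtain ⟨⟨p, y⟩, h1, rfl⟩ := hi
    obtain ⟨⟨p', y'⟩, h2, h3⟩ := hj
    obtain rfl : p' = p := h3
    rw [← (hEmem _ _ _ _ h1).1, ← (hEmem _ _ _ _ h2).1]
  · obtain ⟨i, -, hi⟩ := List.mem_filterMap.1 he
    exact (hEmem n i e.1 e.2 hi).2
  · obtain ⟨k, hk⟩ := Nat.Partrec.Code.evaln_complete.1 ((heval p (encode y)).2 ⟨y, hy, rfl⟩)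
    filter_upwards [Filter.eventually_ge_atTop (max k p.length)] with n hn
    have hev := Nat.Partrec.Code.evaln_mono (le_of_max_le_left hn) hk
    refine List.mem_filterMap.2 ⟨encode p,
      List.mem_range.2 (Nat.Partrec.Code.evaln_bound hev), ?_⟩
    simp only [hE, encodek₂, Option.bind_some, if_pos (le_of_max_le_right hn)]
    rw [Option.mem_def.1 hev]
    simp

end Stages

/-- The natural number with binary expansion `y`. -/
def binaryVal (y : List Bool) : ℕ := y.foldl (fun a b => 2 * a + b.toNat) 0

theorem Primrec.binaryVal : Primrec binaryVal :=
  Primrec.list_foldl Primrec.id (Primrec.const 0)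
    (Primrec.nat_add.comp (Primrec.nat_mul.comp (Primrec.const 2) (Primrec.fst.comp Primrec.snd))
      ((Primrec.dom_bool Bool.toNat).comp (Primrec.snd.comp Primrec.snd))).to₂

theorem binaryVal_prefixStr_div (x : ℕ → Bool) (m : ℕ) :
    (binaryVal (prefixStr x m) : ℝ) / 2 ^ m =
      ∑ i ∈ Finset.range m, (if x i then (1 : ℝ) else 0) * (2 : ℝ)⁻¹ ^ (i + 1) := by
  induction m with
  | zero => simp [prefixStr, binaryVal]
  | succ m ih =>
    have h : binaryVal (prefixStr x (m + 1)) = 2 * binaryVal (prefixStr x m) + (x m).toNat := by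
      simp [binaryVal, prefixStr, List.range_succ, List.foldl_append]
    have h' : ((x m).toNat : ℝ) = if x m then (1 : ℝ) else 0 := by cases x m <;> simp
    rw [Finset.sum_range_succ, ← ih, h, ← h', inv_pow]
    push_cast
    field_simp
    ring

theorem binaryVal_prefixStr_bounds (x : ℕ → Bool) (m : ℕ) :
    (binaryVal (prefixStr x m) : ℝ) / 2 ^ m ≤ realDigits x ∧
      realDigits x ≤ (binaryVal (prefixStr x m) : ℝ) / 2 ^ m + (2 : ℝ)⁻¹ ^ m := by
  set d : ℕ → ℝ := fun i => (if x i then (1 : ℝ) else 0) * (2 : ℝ)⁻¹ ^ (i + 1) with hd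
  have hd0 : ∀ i, 0 ≤ d i := fun i => by simp only [hd]; split_ifs <;> positivity
  have hd1 : ∀ i, d i ≤ (2 : ℝ)⁻¹ ^ (i + 1) := fun i => by
    simp only [hd]; split_ifs <;> simp
  have hgeo : HasSum (fun i : ℕ => (2 : ℝ)⁻¹ ^ (i + 1)) 1 := by
    have := (hasSum_geometric_two' (1 : ℝ))
    convert this using 2 with i
    rw [inv_pow, pow_succ]; field_simp
  have hsum : Summable d := Summable.of_nonneg_of_le hd0 hd1 hgeo.summable
  have hsplit := hsum.sum_add_tsum_nat_add m
  have hr : realDigits x = ∑' i, d i := rfl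
  rw [hr, binaryVal_prefixStr_div, ← hsplit]
  have ht0 : 0 ≤ ∑' i, d (i + m) := tsum_nonneg fun i => hd0 _
  have ht1 : ∑' i, d (i + m) ≤ (2 : ℝ)⁻¹ ^ m := by
    have h2 := hgeo.mul_left ((2 : ℝ)⁻¹ ^ m)
    rw [mul_one] at h2
    rw [← h2.tsum_eq]
    refine Summable.tsum_le_tsum (fun i => (hd1 _).trans (le_of_eq ?_))
      ((summable_nat_add_iff m).2 hsum) h2.summable
    rw [← pow_add]; congr 1; ring
  constructor <;> simp only [hd] at * <;> linarith

theorem sum_pow_length_le {r : ℝ} (h0 : 0 ≤ r) (h1 : 2 * r < 1) (F : Finset (List Bool)) :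
    ∑ p ∈ F, r ^ p.length ≤ (1 - 2 * r)⁻¹ := by
  have hmaps : ∀ p ∈ F, p.length ∈ F.image List.length := fun p hp =>
    Finset.mem_image_of_mem _ hp
  rw [← Finset.sum_fiberwise_of_maps_to hmaps]
  have hle : ∀ l ∈ F.image List.length,
      ∑ p ∈ F with p.length = l, r ^ p.length ≤ (2 * r) ^ l := by
    intro l _
    have hcard : (F.filter fun p => p.length = l).card ≤ 2 ^ l := by
      have hsub : (F.filter fun p => p.length = l) ⊆
          (Finset.univ : Finset (List.Vector Bool l)).image List.Vector.toList := by
        intro p hp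
        exact Finset.mem_image.2 ⟨⟨p, (Finset.mem_filter.1 hp).2⟩, Finset.mem_univ _, rfl⟩
      refine (Finset.card_le_card hsub).trans (Finset.card_image_le.trans (le_of_eq ?_))
      rw [Finset.card_univ, card_vector, Fintype.card_bool]
    rw [Finset.sum_congr rfl (fun p hp => by rw [(Finset.mem_filter.1 hp).2] :
      ∀ p ∈ F.filter (fun p => p.length = l), r ^ p.length = r ^ l), Finset.sum_const,
      nsmul_eq_mul, mul_pow]
    gcongr
    exact_mod_cast hcard
  refine (Finset.sum_le_sum hle).trans ?_
  have hg := hasSum_geometric_of_lt_one (by positivity : 0 ≤ 2 * r) h1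
  rw [← hg.tsum_eq]
  exact hg.summable.sum_le_tsum _ fun i _ => by positivity

theorem summable_pow_length {r : ℝ} (h0 : 0 ≤ r) (h1 : 2 * r < 1) (A : Set (List Bool)) :
    Summable fun p : A => r ^ (p : List Bool).length :=
  (summable_of_sum_le (fun p => by positivity) (sum_pow_length_le h0 h1)).subtype A

theorem UnivTM.exists_minimal {T : List Bool →. List Bool} (huniv : UnivTM T) (y : List Bool) :
    ∃ w : List Bool, w.length = Cpx T y ∧ y ∈ T w := by
  obtain ⟨c, hc⟩ := huniv (fun w => Part.some w) Partrec.some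
  obtain ⟨p, -, hp⟩ := hc y trivial
  exact Nat.sInf_mem (s := {n : ℕ | ∃ w : List Bool, w.length = n ∧ y ∈ T w})
    ⟨_, p, rfl, by rw [hp]; exact Part.mem_some _⟩

/-- The sum of `(a / 2 ^ n) ^ |p|` over the entries `(p, _)` of `l`, scaled by `2 ^ (n * n)`. -/
def scaledSum (n a : ℕ) (l : List (List Bool × List Bool)) : ℕ :=
  l.foldr (fun e t => a ^ e.1.length * 2 ^ (n * (n - e.1.length)) + t) 0

theorem Primrec.scaledSum :
    Primrec fun t : ℕ × ℕ × List (List Bool × List Bool) => scaledSum t.1 t.2.1 t.2.2 := by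
  have hlen : Primrec fun q : (ℕ × ℕ × List (List Bool × List Bool)) ×
      ((List Bool × List Bool) × ℕ) => q.2.1.1.length :=
    Primrec.list_length.comp (Primrec.fst.comp (Primrec.fst.comp Primrec.snd))
  have hn : Primrec fun q : (ℕ × ℕ × List (List Bool × List Bool)) ×
      ((List Bool × List Bool) × ℕ) => q.1.1 := Primrec.fst.comp Primrec.fst
  exact Primrec.list_foldr (Primrec.snd.comp Primrec.snd) (Primrec.const 0)
    (Primrec.nat_add.comp
      (Primrec.nat_mul.comp
        (Primrec.nat_pow.comp (Primrec.fst.comp (Primrec.snd.comp Primrec.fst)) hlen)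
        (Primrec.nat_pow.comp (Primrec.const 2)
          (Primrec.nat_mul.comp hn (Primrec.nat_sub.comp hn hlen))))
      (Primrec.snd.comp Primrec.snd)).to₂

theorem scaledSum_eq (n a : ℕ) (l : List (List Bool × List Bool))
    (hl : ∀ e ∈ l, e.1.length ≤ n) (hnd : (l.map Prod.fst).Nodup) :
    (scaledSum n a l : ℝ) =
      2 ^ (n * n) * ∑ p ∈ (l.map Prod.fst).toFinset, ((a : ℝ) / 2 ^ n) ^ p.length := by
  rw [List.sum_toFinset _ hnd]
  clear hnd
  induction l with
  | nil => simp [scaledSum]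
  | cons e l ih =>
    have h1 := ih fun e' he' => hl e' (List.mem_cons_of_mem _ he')
    have h2 : scaledSum n a (e :: l) =
      a ^ e.1.length * 2 ^ (n * (n - e.1.length)) + scaledSum n a l := rfl
    have h3 : n * n = n * (n - e.1.length) + n * e.1.length := by
      rw [← Nat.mul_add, Nat.sub_add_cancel (hl e List.mem_cons_self)]
    have h4 : (a : ℝ) ^ e.1.length * 2 ^ (n * (n - e.1.length)) =
        2 ^ (n * n) * ((a : ℝ) / 2 ^ n) ^ e.1.length := by
      rw [div_pow, ← pow_mul, h3, pow_add]
      field_simp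
    rw [h2, List.map_cons, List.map_cons, List.sum_cons, mul_add, ← h1, ← h4]
    push_cast
    ring

/-- A string longer than every output listed in `l`. -/
def longString (l : List (List Bool × List Bool)) : List Bool :=
  (List.range (l.foldr (fun e t => e.2.length + t) 0 + 1)).map fun _ => true

theorem Primrec.longString : Primrec longString :=
  Primrec.list_map (Primrec.list_range.comp (Primrec.succ.comp
    (Primrec.list_foldr Primrec.id (Primrec.const 0)
      (Primrec.nat_add.comp
        (Primrec.list_length.comp (Primrec.snd.comp (Primrec.fst.comp Primrec.snd)))
        (Primrec.snd.comp Primrec.snd)).to₂))) (Primrec.const true).to₂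

theorem longString_ne {l : List (List Bool × List Bool)} {e : List Bool × List Bool}
    (he : e ∈ l) : e.2 ≠ longString l := by
  intro h
  have h1 := congrArg List.length h
  simp only [longString, List.length_map, List.length_range] at h1
  have h2 : e.2.length ≤ l.foldr (fun e t => e.2.length + t) 0 := by
    clear h h1
    induction l with
    | nil => simp at he
    | cons a l ih =>
      rcases List.mem_cons.1 he with rfl | h
      · simp
      · exact (ih h).trans (by simp)
  omega

theorem kappa_eq (T : List Bool →. List Bool) (s : ℝ) :
    kappa T s = (1 - 2 * (2 : ℝ) ^ (-s)) *
      ∑' p : dom T, ((2 : ℝ) ^ (-s)) ^ (p : List Bool).length := by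
  have h1 : (2 : ℝ) ^ (-s + 1) = 2 * (2 : ℝ) ^ (-s) := by
    rw [Real.rpow_add (by norm_num), Real.rpow_one, mul_comm]
  have h2 : ∀ p : dom T, (2 : ℝ) ^ (-(s * ((p : List Bool).length : ℝ))) =
      ((2 : ℝ) ^ (-s)) ^ (p : List Bool).length := fun p => by
    rw [← neg_mul, Real.rpow_mul (by norm_num), Real.rpow_natCast]
  simp only [kappa, h1, h2]

theorem sum_pow_length_le_tsum {r : ℝ} (h0 : 0 ≤ r) (h1 : 2 * r < 1) (A : Set (List Bool))
    (G : Finset (List Bool)) (hG : ∀ p ∈ G, p ∈ A) :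
    ∑ p ∈ G, r ^ p.length ≤ ∑' p : A, r ^ (p : List Bool).length := by
  classical
  rw [← Finset.sum_subtype_of_mem (p := (· ∈ A)) (fun p => r ^ p.length) hG]
  exact (summable_pow_length h0 h1 A).sum_le_tsum _ fun p _ => by positivity

/-- There is a computable sequence of finite stages such that the `n`-th stage, together with
computable dyadic approximations of the weights, gives an effectively testable lower bound of
`kappa T s`, and these lower bounds come arbitrarily close to `kappa T s`. -/
theorem exists_lower_approximation {s : ℝ} (hs : ComputableReal s) (hs1 : 1 < s)
    {T : List Bool →. List Bool} (hT : Partrec T) :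
    ∃ (st : ℕ → List (List Bool × List Bool)) (a : ℕ → ℝ) (test : List Bool → ℕ → Bool),
      Computable st ∧ Computable₂ test ∧
      (∀ y n, test y n = true ↔ (binaryVal y : ℝ) ≤ 2 ^ y.length * a n + 1) ∧
      (∀ ε > 0, ∃ n, kappa T s - ε < a n) ∧
      ∀ n p y, y ∈ T p → (p, y) ∉ st n →
        (1 - 2 * (2 : ℝ) ^ (-s)) * ((2 : ℝ) ^ (-s)) ^ p.length ≤ kappa T s - a n := by
  obtain ⟨lo, hi, hloc, hhic, hlo, hhi, hlot, hhit⟩ :=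
    hs.exists_dyadic_bounds (zero_lt_one.trans hs1)
  obtain ⟨st, hstc, hnd, hst, hcomplete⟩ := hT.exists_stages_s12
  set r : ℝ := (2 : ℝ) ^ (-s) with hr
  have hr0 : 0 < r := by positivity
  have hr1 : 2 * r < 1 := by
    have h : r < (2 : ℝ) ^ (-1 : ℝ) := Real.rpow_lt_rpow_of_exponent_lt (by norm_num) (by linarith)
    rw [Real.rpow_neg_one] at h
    linarith
  have hk : kappa T s = (1 - 2 * r) * ∑' p : dom T, r ^ (p : List Bool).length := kappa_eq T s
  set F : ℕ → Finset (List Bool) := fun n => ((st n).map Prod.fst).toFinset with hF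
  have hFdom : ∀ n, ∀ p ∈ F n, p ∈ dom T := by
    intro n p hp
    obtain ⟨e, he, rfl⟩ := List.mem_map.1 (List.mem_toFinset.1 hp)
    exact Part.dom_iff_mem.2 ⟨_, (hst n e he).1⟩
  set b : ℕ → ℝ := fun n => ((2 ^ n - 2 * hi n : ℕ) : ℝ) / 2 ^ n with hb
  have hb0 : ∀ n, 0 ≤ b n := fun n => by positivity
  have hb1 : ∀ n, 1 - 2 * ((hi n : ℝ) / 2 ^ n) ≤ b n := by
    intro n
    have h : ((2 ^ n : ℕ) : ℝ) - (2 * hi n : ℕ) ≤ ((2 ^ n - 2 * hi n : ℕ) : ℝ) := by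
      rw [sub_le_iff_le_add]
      exact_mod_cast (by omega : 2 ^ n ≤ 2 ^ n - 2 * hi n + 2 * hi n)
    have e : 1 - 2 * ((hi n : ℝ) / 2 ^ n) = (((2 ^ n : ℕ) : ℝ) - (2 * hi n : ℕ)) / 2 ^ n := by
      push_cast
      field_simp
    rw [e]
    simp only [hb]
    gcongr
  have hb2 : ∀ n, b n ≤ 1 - 2 * r := by
    intro n
    rcases le_total (2 * hi n) (2 ^ n) with h | h
    · have e : b n = 1 - 2 * ((hi n : ℝ) / 2 ^ n) := by
        simp only [hb]
        rw [Nat.cast_sub h]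
        push_cast
        field_simp
      linarith [hhi n]
    · have e : b n = 0 := by simp [hb, Nat.sub_eq_zero_of_le h]
      linarith
  set a : ℕ → ℝ := fun n => b n * ∑ p ∈ F n, ((lo n : ℝ) / 2 ^ n) ^ p.length with ha
  refine ⟨st, a, fun y n => decide (binaryVal y * 2 ^ n * 2 ^ (n * n) ≤
    2 ^ y.length * ((2 ^ n - 2 * hi n) * scaledSum n (lo n) (st n)) + 2 ^ n * 2 ^ (n * n)),
    hstc, ?_, ?_, ?_, ?_⟩
  · have hn : Computable fun q : List Bool × ℕ => q.2 := Computable.snd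
    have hp : ∀ {f : List Bool × ℕ → ℕ}, Computable f → Computable fun q => 2 ^ f q :=
      fun hf => Primrec.nat_pow.to_comp.comp (Computable.const 2) hf
    have hm : ∀ {f g : List Bool × ℕ → ℕ}, Computable f → Computable g →
      Computable fun q => f q * g q := fun hf hg => Primrec.nat_mul.to_comp.comp hf hg
    have hw : Computable fun q : List Bool × ℕ => scaledSum q.2 (lo q.2) (st q.2) :=
      Primrec.scaledSum.to_comp.comp (hn.pair ((hloc.comp hn).pair (hstc.comp hn)))
    exact Primrec.nat_le.decide.to_comp.comp
      (hm (hm (Primrec.binaryVal.to_comp.comp Computable.fst) (hp hn)) (hp (hm hn hn)))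
      (Primrec.nat_add.to_comp.comp
        (hm (hp (Computable.list_length.comp Computable.fst))
          (hm (Primrec.nat_sub.to_comp.comp (hp hn) (hm (Computable.const 2) (hhic.comp hn))) hw))
        (hm (hp hn) (hp (hm hn hn))))
  · intro y n
    rw [decide_eq_true_iff, ← Nat.cast_le (α := ℝ)]
    have hw := scaledSum_eq n (lo n) (st n) (fun e he => (hst n e he).2) (hnd n)
    have hbn : ((2 ^ n - 2 * hi n : ℕ) : ℝ) = b n * 2 ^ n := by
      simp only [hb]
      field_simp
    rw [Nat.cast_add, Nat.cast_mul, Nat.cast_mul, Nat.cast_mul, Nat.cast_mul, Nat.cast_mul, hw,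
      hbn]
    push_cast
    have hpos : (0 : ℝ) < 2 ^ n * 2 ^ (n * n) := by positivity
    rw [← mul_le_mul_iff_left₀ hpos (b := (binaryVal y : ℝ))]
    refine iff_of_eq ?_
    congr 1
    · ring
    · simp only [ha, hF]
      ring
  · intro ε hε
    have hsum := ((summable_pow_length hr0.le hr1 (dom T)).hasSum.mul_left (1 - 2 * r))
    rw [← hk] at hsum
    obtain ⟨G, hG⟩ := (hsum.eventually_const_lt (sub_lt_self _ hε)).exists
    rw [← Finset.mul_sum] at hG
    have hlim : Filter.Tendsto (fun n => (1 - 2 * ((hi n : ℝ) / 2 ^ n)) *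
        ∑ p ∈ G, ((lo n : ℝ) / 2 ^ n) ^ (p : List Bool).length) Filter.atTop
        (nhds ((1 - 2 * r) * ∑ p ∈ G, r ^ (p : List Bool).length)) :=
      (tendsto_const_nhds.sub (hhit.const_mul 2)).mul
        (tendsto_finsetSum _ fun p _ => hlot.pow _)
    have hsub : ∀ᶠ n in Filter.atTop, ∀ p ∈ G, (p : List Bool) ∈ F n := by
      rw [Filter.eventually_all_finset]
      intro p _
      obtain ⟨y, hy⟩ := Part.dom_iff_mem.1 p.2
      filter_upwards [hcomplete p y hy] with n hn
      exact List.mem_toFinset.2 (List.mem_map.2 ⟨_, hn, rfl⟩)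
    obtain ⟨n, h1, h2⟩ := ((hlim.eventually_const_lt hG).and hsub).exists
    refine ⟨n, h1.trans_le ?_⟩
    refine (mul_le_mul_of_nonneg_right (hb1 n) (by positivity)).trans
      (mul_le_mul_of_nonneg_left ?_ (hb0 n))
    refine (Finset.sum_map G (Function.Embedding.subtype (· ∈ dom T))
      (fun p : List Bool => ((lo n : ℝ) / 2 ^ n) ^ p.length)).symm.le.trans ?_
    refine Finset.sum_le_sum_of_subset_of_nonneg ?_ fun _ _ _ => by positivity
    intro p hp
    obtain ⟨q, hq, rfl⟩ := Finset.mem_map.1 hp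
    exact h2 q hq
  · intro n p y hy hp
    have hpF : p ∉ F n := by
      intro h
      obtain ⟨e, he, rfl⟩ := List.mem_map.1 (List.mem_toFinset.1 h)
      exact hp (by rwa [Part.mem_unique hy (hst n e he).1])
    have h1 : a n ≤ (1 - 2 * r) * ∑ q ∈ F n, r ^ q.length :=
      mul_le_mul (hb2 n) (Finset.sum_le_sum fun q _ =>
        pow_le_pow_left₀ (by positivity) (hlo n) _) (by positivity) (by linarith)
    have h2 := sum_pow_length_le_tsum hr0.le hr1 (dom T) (insert p (F n)) (by
      intro q hq
      rcases Finset.mem_insert.1 hq with rfl | hq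
      · exact Part.dom_iff_mem.2 ⟨y, hy⟩
      · exact hFdom n q hq)
    have h3 := mul_le_mul_of_nonneg_left h2 (by linarith : 0 ≤ 1 - 2 * r)
    rw [Finset.sum_insert hpF, ← hk, mul_add] at h3
    linarith

/-- For every computable real `s > 1` and every universal Turing machine `T`,
`⟨κ_T⟩(s)` is `1/s`-`K`-random. -/
theorem stmt_12 (s : ℝ) (hs : ComputableReal s) (hs1 : 1 < s)
    (T : List Bool →. List Bool) (hT : Partrec T) (huniv : UnivTM T)
    (x : ℕ → Bool) (hx : kappa T s = realDigits x) :
    ∃ c : ℝ, 0 ≤ c ∧ ∀ m : ℕ, 1 ≤ m →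
      (Cpx T (prefixStr x m) : ℝ) ≥ m / s - c := by
  obtain ⟨st, a, test, hstc, htestc, htest, hlim, htail⟩ := exists_lower_approximation hs hs1 hT
  have hs0 : 0 < s := zero_lt_one.trans hs1
  have hd : 0 < 1 - 2 * (2 : ℝ) ^ (-s) := by
    have h : (2 : ℝ) ^ (-s) < (2 : ℝ) ^ (-1 : ℝ) :=
      Real.rpow_lt_rpow_of_exponent_lt (by norm_num) (by linarith)
    rw [Real.rpow_neg_one] at h
    linarith
  set M : List Bool →. List Bool := fun w => (T w).bind fun y =>
    (Nat.rfind fun n => (Part.some (test y n) : Part Bool)).map fun n => longString (st n) with hM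
  have hMc : Partrec M := by
    refine hT.bind (Partrec.map (Partrec.rfind ?_) ?_)
    · exact (Computable₂.comp htestc (Computable.snd.comp Computable.fst)
        Computable.snd).partrec
    · exact Primrec.longString.to_comp.comp (hstc.comp Computable.snd)
  obtain ⟨c, hc⟩ := huniv M hMc
  obtain ⟨k, hk⟩ := exists_nat_gt (1 - Real.logb 2 (1 - 2 * (2 : ℝ) ^ (-s)))
  refine ⟨c + k / s, by positivity, fun m _ => ?_⟩
  set y := prefixStr x m with hy
  have hylen : y.length = m := length_prefixStr x m
  obtain ⟨hlow, hupp⟩ := binaryVal_prefixStr_bounds x m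
  rw [← hx, ← hy] at hlow hupp
  obtain ⟨w, hwlen, hw⟩ := huniv.exists_minimal y
  have h2m : (0 : ℝ) < 2 ^ m := by positivity
  have hdomain : (Nat.rfind fun n => (Part.some (test y n) : Part Bool)).Dom := by
    obtain ⟨n, hn⟩ := hlim ((2 : ℝ)⁻¹ ^ m) (by positivity)
    refine Nat.rfind_dom.2 ⟨n, ?_, fun _ => trivial⟩
    rw [Part.mem_some_iff, eq_comm, htest, hylen]
    have h : (binaryVal y : ℝ) / 2 ^ m - (2 : ℝ)⁻¹ ^ m < a n := by linarith
    rw [inv_pow, inv_eq_one_div, ← sub_div, div_lt_iff₀ h2m] at h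
    linarith
  obtain ⟨n, hn⟩ := Part.dom_iff_mem.1 hdomain
  have hz : longString (st n) ∈ M w := by
    simp only [hM, Part.mem_bind_iff, Part.mem_map_iff]
    exact ⟨y, hw, n, hn, rfl⟩
  obtain ⟨p, hplen, hp⟩ := hc w (Part.dom_iff_mem.2 ⟨_, hz⟩)
  rw [← hp] at hz
  have hpst : (p, longString (st n)) ∉ st n := fun h => longString_ne h rfl
  have hsmall := htail n p _ hz hpst
  have ha : kappa T s - a n ≤ 2 * (2 : ℝ)⁻¹ ^ m := by
    have h := (htest y n).1 (Part.mem_some_iff.1 (Nat.rfind_spec hn)).symm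
    rw [hylen, ← sub_le_iff_le_add, ← div_le_iff₀' h2m, sub_div, ← inv_eq_one_div,
      ← inv_pow] at h
    linarith
  have hlog := Real.logb_le_logb_of_le (b := 2) (by norm_num) (by positivity) (hsmall.trans ha)
  rw [Real.logb_mul hd.ne' (by positivity), Real.logb_mul (by norm_num) (by positivity),
    Real.logb_pow, Real.logb_pow, Real.logb_rpow (by norm_num) (by norm_num), Real.logb_inv,
    Real.logb_self_eq_one (by norm_num)] at hlog
  have hmain : (m : ℝ) - k ≤ s * p.length := by linarith
  have hplen' : (p.length : ℝ) ≤ Cpx T y + c := by rw [← hwlen]; exact_mod_cast hplen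
  have hdiv : ((m : ℝ) - k) / s ≤ p.length := by
    rw [div_le_iff₀ hs0]
    linarith
  rw [sub_div] at hdiv
  linarith
end
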